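/- (Theorem 3) Assume the Riemann hypothesis. Then there exists B > 0 such that for all sufficiently large T and for every natural number k with 1 ≤ k ≤ ⌊B·ln(ln T)/ln(ln(ln T))⌋, the open interval (T, T + 1/ln(ln(ln T))) contains a root of odd order of the k-th derivative Z^{(k)} of Hardy's function; in particular there exist t₁ < t₂ in (T, T + 1/ln(ln(ln T))) with Z^{(k)}(t₁)·Z^{(k)}(t₂) < 0. -/

import Mathlib

open Filter Topology

noncomputable def theta (t : ℝ) : ℝ :=
  (Complex.log (Complex.Gamma (1/4 + Complex.I * t / 2))).im - t / 2 * Real.log Real.pi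

noncomputable def hardyZ (t : ℝ) : ℝ :=
  (Complex.exp (Complex.I * theta t) * riemannZeta (1/2 + Complex.I * t)).re

/-- An analytic function on the line that is monotone and has two zeros vanishes identically. -/
lemma eq_zero_of_monotoneOn_of_two_zeros {f : ℝ → ℝ} (hf : AnalyticOnNhd ℝ f Set.univ)
    {p q : ℝ} (hpq : p < q) (hp : f p = 0) (hq : f q = 0)
    (hmono : MonotoneOn f (Set.Icc p q)) : f = 0 := by
  have hzero : ∀ x ∈ Set.Icc p q, f x = 0 := fun x hx =>
    le_antisymm (hq ▸ hmono hx (Set.right_mem_Icc.2 hpq.le) hx.2)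
      (hp ▸ hmono (Set.left_mem_Icc.2 hpq.le) hx hx.1)
  have hev : f =ᶠ[𝓝 ((p + q) / 2)] 0 := by
    filter_upwards [Icc_mem_nhds (show p < (p + q) / 2 by linarith)
      (show (p + q) / 2 < q by linarith)] with x hx using hzero x hx
  exact hf.eq_of_eventuallyEq (fun x _ => analyticAt_const) hev

/-- If an analytic function on the line has `k + 1` distinct zeros, `k ≥ 1`, then its `k`-th
derivative changes sign between the smallest and the largest of them. -/
lemma exists_sign_change_iteratedDeriv {k : ℕ} (hk : 1 ≤ k) :
    ∀ {f : ℝ → ℝ}, AnalyticOnNhd ℝ f Set.univ → f ≠ 0 → ∀ z : ℕ → ℝ,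
      (∀ i < k, z i < z (i + 1)) → (∀ i ≤ k, f (z i) = 0) →
      ∃ t₁ t₂ : ℝ, z 0 ≤ t₁ ∧ t₁ < t₂ ∧ t₂ ≤ z k ∧
        iteratedDeriv k f t₁ * iteratedDeriv k f t₂ < 0 := by
  induction k, hk using Nat.le_induction with
  | base =>
    intro f hf hf0 z hz hfz
    by_contra! hcon
    have h01 : z 0 < z 1 := hz 0 one_pos
    simp only [iteratedDeriv_one] at hcon
    have hdiff : Differentiable ℝ f := fun x => (hf x trivial).differentiableAt
    have hsign : (∀ x ∈ Set.Icc (z 0) (z 1), 0 ≤ deriv f x) ∨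
        (∀ x ∈ Set.Icc (z 0) (z 1), 0 ≤ deriv (-f) x) := by
      by_contra! h
      obtain ⟨⟨a, ha, ha'⟩, b, hb, hb'⟩ := h
      rw [deriv.neg] at hb'
      rcases lt_trichotomy a b with hab | hab | hab
      · have := hcon a b ha.1 hab hb.2
        nlinarith
      · subst hab; linarith
      · have := hcon b a hb.1 hab ha.2
        nlinarith
    have hint : ∀ x ∈ interior (Set.Icc (z 0) (z 1)), x ∈ Set.Icc (z 0) (z 1) :=
      fun x hx => interior_subset hx
    rcases hsign with h | h
    · exact hf0 (eq_zero_of_monotoneOn_of_two_zeros hf h01 (hfz 0 zero_le_one) (hfz 1 le_rfl)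
        (monotoneOn_of_deriv_nonneg (convex_Icc _ _) hdiff.continuous.continuousOn
          hdiff.differentiableOn fun x hx => h x (hint x hx)))
    · refine hf0 (neg_eq_zero.1 (eq_zero_of_monotoneOn_of_two_zeros (f := -f) (hf.neg) h01 ?_ ?_
        (monotoneOn_of_deriv_nonneg (convex_Icc _ _) hdiff.neg.continuous.continuousOn
          hdiff.neg.differentiableOn fun x hx => h x (hint x hx))))
      · simp [hfz 0 zero_le_one]
      · simp [hfz 1 le_rfl]
  | succ k hk ih =>
    intro f hf hf0 z hz hfz
    have hdiff : Differentiable ℝ f := fun x => (hf x trivial).differentiableAt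
    have hrolle : ∀ i, ∃ y, i ≤ k → z i < y ∧ y < z (i + 1) ∧ deriv f y = 0 := by
      intro i
      by_cases hi : i ≤ k
      · obtain ⟨y, hy, hy'⟩ := exists_deriv_eq_zero (hz i (by omega))
          hdiff.continuous.continuousOn ((hfz i (by omega)).trans (hfz (i + 1) (by omega)).symm)
        exact ⟨y, fun _ => ⟨hy.1, hy.2, hy'⟩⟩
      · exact ⟨0, fun h => absurd h hi⟩
    choose y hy using hrolle
    have hf0' : deriv f ≠ 0 := by
      intro h
      refine hf0 (funext fun x => ?_)
      rw [is_const_of_deriv_eq_zero hdiff (fun x => congrFun h x) x (z 0), hfz 0 (by omega)]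
      rfl
    obtain ⟨t₁, t₂, h1, h2, h3, h4⟩ := ih (f := deriv f) hf.deriv hf0' y
      (fun i hi => (hy i hi.le).2.1.trans (hy (i + 1) hi).1) (fun i hi => (hy i hi).2.2)
    refine ⟨t₁, t₂, (hy 0 (by omega)).1.le.trans h1, h2, h3.trans (hy k le_rfl).2.1.le, ?_⟩
    rwa [iteratedDeriv_succ']

/-- A Hadamard three circles estimate near the boundary of a disc of radius `5 / 2`. -/
theorem norm_le_rpow_of_three_circles {f : ℂ → ℂ} {c : ℂ} {ε x : ℝ}
    (hf : DifferentiableOn ℂ f (Metric.ball c (5 / 2)))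
    (hf_one : ∀ z ∈ Metric.ball c (5 / 2), ‖f z‖ ≤ 1)
    (hε : 0 < ε) (hε_one : ε ≤ 1) (hf_eps : ∀ z ∈ Metric.closedBall c 1, ‖f z‖ ≤ ε)
    (hx : 0 < x) (hx_one : x < 1) :
    ‖f (c - ((5 / 2 - x : ℝ) : ℂ))‖ ≤ ε ^ (x / 5) := by
  set u := Real.log (5 / 2 - x / 2) with hu
  have hu_pos : 0 < u := Real.log_pos (by linarith)
  have hu_one : u ≤ 1 := by
    have : u ≤ Real.log (Real.exp 1) :=
      Real.log_le_log (by linarith) (by have := Real.exp_one_gt_d9; linarith)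
    simpa using this
  set v := Real.log (5 / 2 - x) with hv
  have hv_pos : 0 ≤ v := Real.log_nonneg (by linarith)
  have hvu : x / 5 ≤ u - v := by
    have h1 : u - v = Real.log ((5 / 2 - x / 2) / (5 / 2 - x)) := by
      rw [Real.log_div (by linarith) (by linarith)]
    have h2 := Real.one_sub_inv_le_log_of_pos
      (show 0 < (5 / 2 - x / 2) / (5 / 2 - x) by apply div_pos <;> linarith)
    have h3 : x / 5 ≤ 1 - ((5 / 2 - x / 2) / (5 / 2 - x))⁻¹ := by
      rw [inv_div, one_sub_div (by linarith), div_le_div_iff₀ (by norm_num) (by linarith)]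
      nlinarith
    linarith
  have hmap : ∀ w : ℂ, w.re ≤ u → c + Complex.exp w ∈ Metric.ball c (5 / 2) := by
    intro w hw
    have : Real.exp w.re ≤ 5 / 2 - x / 2 := by
      rw [← Real.exp_log (show 0 < 5 / 2 - x / 2 by linarith)]
      exact Real.exp_le_exp.mpr hw
    simp only [Metric.mem_ball, dist_self_add_left, Complex.norm_exp]
    linarith
  have hdiff : ∀ w : ℂ, w.re ≤ u → DifferentiableAt ℂ (fun w => f (c + Complex.exp w)) w := by
    intro w hw
    have h1 := hf.differentiableAt (Metric.isOpen_ball.mem_nhds (hmap w hw))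
    exact h1.comp w (by fun_prop : DifferentiableAt ℂ (fun w => c + Complex.exp w) w)
  have key := Complex.HadamardThreeLines.norm_le_interp_of_mem_verticalClosedStrip'
    (f := fun w => f (c + Complex.exp w)) (z := v + Real.pi * Complex.I) (a := ε) (b := 1)
    (l := 0) (u := u) hu_pos ?_ ?_ ?_ ?_ ?_
  · have hexp : Complex.exp (v + Real.pi * Complex.I) = -((5 / 2 - x : ℝ) : ℂ) := by
      rw [Complex.exp_add, Complex.exp_pi_mul_I, ← Complex.ofReal_exp, Real.exp_log (by linarith)]
      ring
    simp only [hexp, ← sub_eq_add_neg, Real.one_rpow, mul_one] at key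
    refine key.trans (Real.rpow_le_rpow_of_exponent_ge hε hε_one ?_)
    have : ((v : ℂ) + Real.pi * Complex.I).re = v := by simp
    rw [this, sub_zero, sub_zero, one_sub_div hu_pos.ne', le_div_iff₀ hu_pos]
    nlinarith
  · simp only [Complex.HadamardThreeLines.verticalClosedStrip, Set.mem_preimage, Set.mem_Icc]
    simp only [Complex.add_re, Complex.ofReal_re, Complex.mul_re, Complex.I_re, mul_zero,
      Complex.ofReal_im, Complex.I_im, mul_one, sub_self, add_zero]
    exact ⟨hv_pos, by linarith⟩
  · apply DifferentiableOn.diffContOnCl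
    intro w hw
    refine (hdiff w ?_).differentiableWithinAt
    have : closure (Complex.HadamardThreeLines.verticalStrip 0 u) ⊆
        Complex.HadamardThreeLines.verticalClosedStrip 0 u :=
      closure_minimal (Set.preimage_mono Set.Ioo_subset_Icc_self)
        (isClosed_Icc.preimage Complex.continuous_re)
    exact (this hw).2
  · refine ⟨1, ?_⟩
    rintro _ ⟨w, hw, rfl⟩
    exact hf_one _ (hmap w hw.2)
  · intro w hw
    apply hf_eps
    have : w.re = 0 := hw
    simp [Complex.norm_exp, this]
  · intro w hw
    exact hf_one _ (hmap w (le_of_eq hw))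

theorem exists_exp_eq_of_ne_zero_on_ball {F : ℂ → ℂ} {c : ℂ} {R : ℝ} (hR : 0 < R)
    (hF : DifferentiableOn ℂ F (Metric.ball c R)) (hF_ne : ∀ z ∈ Metric.ball c R, F z ≠ 0) :
    ∃ g : ℂ → ℂ, DifferentiableOn ℂ g (Metric.ball c R) ∧ g c = 0 ∧
      ∀ z ∈ Metric.ball c R, F z = F c * Complex.exp (g z) := by
  have hlog : DifferentiableOn ℂ (fun z => deriv F z / F z) (Metric.ball c R) :=
    (hF.deriv Metric.isOpen_ball).div hF hF_ne
  obtain ⟨G, hG⟩ := hlog.isExactOn_ball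
  have hc : c ∈ Metric.ball c R := Metric.mem_ball_self hR
  refine ⟨fun z => G z - G c, fun z hz =>
    ((hG z hz).differentiableAt.sub_const _).differentiableWithinAt, by simp, ?_⟩
  intro z hz
  have hderiv : ∀ w ∈ Metric.ball c R,
      HasDerivAt (fun w => F w * Complex.exp (-(G w - G c))) 0 w := by
    intro w hw
    have h1 := (hF.differentiableAt (Metric.isOpen_ball.mem_nhds hw)).hasDerivAt
    have h2 := (((hG w hw).sub_const (G c)).neg).cexp
    have h3 := h1.mul h2
    have h4 : F w * (Complex.exp ((-fun x => G x - G c) w) * -(deriv F w / F w)) =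
        -(deriv F w * Complex.exp ((-fun x => G x - G c) w)) := by
      have := hF_ne w hw
      field_simp
    rw [h4, add_neg_cancel] at h3
    exact h3
  have hconst := Metric.isOpen_ball.is_const_of_deriv_eq_zero (convex_ball c R).isPreconnected
    (fun w hw => (hderiv w hw).differentiableAt.differentiableWithinAt)
    (fun w hw => (hderiv w hw).deriv) hz hc
  simp only [sub_self, neg_zero, Complex.exp_zero, mul_one] at hconst
  rw [← hconst, mul_assoc, ← Complex.exp_add]
  simp

/-- Lower bound for a zero-free holomorphic function on a disc, by the Borel–Carathéodory theorem
applied to its logarithm. -/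
theorem norm_ge_of_ne_zero_on_ball {F : ℂ → ℂ} {c : ℂ} {R M : ℝ} (hR : 0 < R) (hM : 0 < M)
    (hF : DifferentiableOn ℂ F (Metric.ball c R)) (hF_ne : ∀ z ∈ Metric.ball c R, F z ≠ 0)
    (hF_le : ∀ z ∈ Metric.ball c R, ‖F z‖ ≤ ‖F c‖ * Real.exp M) {z : ℂ}
    (hz : z ∈ Metric.ball c R) :
    ‖F c‖ * Real.exp (-(2 * M * ‖z - c‖ / (R - ‖z - c‖))) ≤ ‖F z‖ := by
  obtain ⟨g, hg, hgc, hgF⟩ := exists_exp_eq_of_ne_zero_on_ball hR hF hF_ne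
  have hFc : 0 < ‖F c‖ := norm_pos_iff.mpr (hF_ne c (Metric.mem_ball_self hR))
  have hmem : ∀ w ∈ Metric.ball (0 : ℂ) R, c + w ∈ Metric.ball c R := by
    intro w hw
    simpa using hw
  have hbc := Complex.borelCaratheodory_zero (f := fun w => g (c + w)) (z := z - c) hM
    (hg.comp (by fun_prop) hmem) ?_ hR (by simpa [dist_eq_norm] using hz) (by simpa using hgc)
  · rw [hgF z hz, norm_mul, Complex.norm_exp]
    gcongr
    simp only [add_sub_cancel] at hbc
    linarith [(abs_le.mp ((Complex.abs_re_le_norm (g z)))).1]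
  · intro w hw
    have h := hF_le _ (hmem w hw)
    rw [hgF _ (hmem w hw), norm_mul, Complex.norm_exp] at h
    exact Real.exp_le_exp.mp (le_of_mul_le_mul_left h hFc)

theorem tendsto_deriv_of_norm_le {f : ℕ → ℂ → ℂ} {g : ℂ → ℂ} {U : Set ℂ} {z : ℂ} {r C : ℝ}
    (hU : IsOpen U) (hr : 0 < r) (hzr : Metric.closedBall z r ⊆ U)
    (hf : ∀ᶠ n in atTop, DifferentiableOn ℂ (f n) U) (hg : DifferentiableOn ℂ g U)
    (hC : ∀ᶠ n in atTop, ∀ w ∈ Metric.sphere z r, ‖f n w‖ ≤ C)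
    (hfg : ∀ w ∈ Metric.sphere z r, Tendsto (fun n => f n w) atTop (𝓝 (g w))) :
    Tendsto (fun n => deriv (f n) z) atTop (𝓝 (deriv g z)) := by
  have key : Tendsto (fun n => Complex.cderiv r (f n) z) atTop (𝓝 (Complex.cderiv r g z)) := by
    unfold Complex.cderiv
    refine Tendsto.const_smul ?_ _
    unfold circleIntegral
    refine intervalIntegral.tendsto_integral_filter_of_dominated_convergence
      (fun _ => r * ((r ^ 2)⁻¹ * C)) ?_ ?_ intervalIntegrable_const ?_
    · filter_upwards [hf] with n hn
      apply Continuous.aestronglyMeasurable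
      have h1 : Continuous fun θ : ℝ => f n (circleMap z r θ) :=
        hn.continuousOn.comp_continuous (continuous_circleMap z r)
          fun θ => hzr (Metric.sphere_subset_closedBall (circleMap_mem_sphere z hr.le θ))
      have h2 : Continuous fun θ : ℝ => ((circleMap z r θ - z) ^ 2)⁻¹ := by
        refine Continuous.inv₀ (by fun_prop) fun θ => ?_
        simp [hr.ne']
      have h3 : Continuous (deriv (circleMap z r)) := by
        have : deriv (circleMap z r) = fun θ => circleMap 0 r θ * Complex.I := by
          ext θ; simp
        rw [this]; fun_prop
      exact h3.smul (h2.smul h1)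
    · filter_upwards [hC] with n hn
      refine Eventually.of_forall fun θ _ => ?_
      have := hn _ (circleMap_mem_sphere z hr.le θ)
      simp only [deriv_circleMap, norm_smul, norm_mul, norm_circleMap_zero, abs_of_pos hr,
        Complex.norm_I, mul_one, norm_inv, norm_pow, circleMap_sub_center]
      gcongr
    · refine Eventually.of_forall fun θ _ => ?_
      exact ((hfg _ (circleMap_mem_sphere z hr.le θ)).const_smul _).const_smul _
  rw [Complex.cderiv_eq_deriv hU hg hr hzr] at key
  refine key.congr' ?_
  filter_upwards [hf] with n hn
  exact Complex.cderiv_eq_deriv hU hn hr hzr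

theorem Real.gammaSeq_le_Gamma {x : ℝ} (hx : 0 < x) {n : ℕ} (hn : n ≠ 0) :
    Real.GammaSeq x n ≤ Real.Gamma x := by
  have h := Real.BohrMollerup.ge_logGammaSeq (x := x) (n := n) Real.convexOn_log_Gamma
    (fun {y} hy => by
      rw [Function.comp_apply, Real.Gamma_add_one hy.ne',
        Real.log_mul hy.ne' (Real.Gamma_pos_of_pos hy).ne', add_comm, Function.comp_apply]) hx hn
  have hn' : (0 : ℝ) < n := by positivity
  have hpos : ∀ m ∈ Finset.range (n + 1), x + (m : ℝ) ≠ 0 := fun m _ => by positivity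
  have heq : Real.log (Real.GammaSeq x n) = Real.BohrMollerup.logGammaSeq x n := by
    rw [Real.GammaSeq, Real.BohrMollerup.logGammaSeq,
      Real.log_div (by positivity) (Finset.prod_ne_zero_iff.mpr hpos),
      Real.log_mul (by positivity) (by positivity), Real.log_rpow hn', Real.log_prod hpos]
  simp only [Function.comp_apply, Real.Gamma_one, Real.log_one, zero_add] at h
  rw [← heq] at h
  refine (Real.log_le_log_iff ?_ (Real.Gamma_pos_of_pos hx)).mp h
  rw [Real.GammaSeq]
  have : 0 < ∏ j ∈ Finset.range (n + 1), (x + (j : ℝ)) :=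
    Finset.prod_pos fun m _ => by positivity
  positivity

theorem Complex.re_add_natCast_le_norm (s : ℂ) (j : ℕ) : s.re + j ≤ ‖s + j‖ := by
  simpa using Complex.re_le_norm (s + j)

theorem Complex.norm_gammaSeq_le {s : ℂ} (hs : 0 < s.re) {n : ℕ} (hn : n ≠ 0) :
    ‖Complex.GammaSeq s n‖ ≤ Real.Gamma s.re := by
  refine le_trans ?_ (Real.gammaSeq_le_Gamma hs hn)
  have hn' : (0 : ℝ) < n := by positivity
  rw [Complex.GammaSeq, Real.GammaSeq, norm_div, norm_mul, norm_prod, Complex.norm_natCast,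
    ← Complex.ofReal_natCast n, Complex.norm_cpow_eq_rpow_re_of_pos hn']
  have : 0 < ∏ j ∈ Finset.range (n + 1), (s.re + (j : ℝ)) :=
    Finset.prod_pos fun m _ => by positivity
  gcongr
  · exact Complex.re_add_natCast_le_norm s _

theorem Complex.add_natCast_ne_zero {s : ℂ} (hs : 0 < s.re) (j : ℕ) : s + j ≠ 0 := by
  intro h
  have := congrArg Complex.re h
  simp only [Complex.add_re, Complex.natCast_re, Complex.zero_re] at this
  have hj : (0 : ℝ) ≤ j := by positivity
  linarith

theorem Complex.differentiableAt_Gamma_of_re_pos {s : ℂ} (hs : 0 < s.re) :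
    DifferentiableAt ℂ Complex.Gamma s :=
  Complex.differentiableAt_Gamma s fun m hm =>
    Complex.add_natCast_ne_zero hs m (by rw [hm, neg_add_cancel])

theorem Complex.logDeriv_gammaSeq {s : ℂ} (hs : 0 < s.re) {n : ℕ} (hn : n ≠ 0) :
    DifferentiableAt ℂ (fun s => Complex.GammaSeq s n) s ∧
    logDeriv (fun s => Complex.GammaSeq s n) s =
      Real.log n - ∑ j ∈ Finset.range (n + 1), 1 / (s + j) := by
  have hn' : (n : ℂ) ≠ 0 := by exact_mod_cast hn
  have hd1 : DifferentiableAt ℂ (fun s : ℂ => (n : ℂ) ^ s * (n.factorial : ℂ)) s :=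
    (DifferentiableAt.const_cpow differentiableAt_id (Or.inl hn')).mul_const _
  have hd2 : ∀ j ∈ Finset.range (n + 1), DifferentiableAt ℂ (fun s : ℂ => s + (j : ℂ)) s :=
    fun j _ => by fun_prop
  have hne : ∀ j ∈ Finset.range (n + 1), s + (j : ℂ) ≠ 0 :=
    fun j _ => Complex.add_natCast_ne_zero hs j
  have hd3 : DifferentiableAt ℂ (fun s : ℂ => ∏ j ∈ Finset.range (n + 1), (s + (j : ℂ))) s := by
    fun_prop
  have hne3 : ∏ j ∈ Finset.range (n + 1), (s + (j : ℂ)) ≠ 0 := Finset.prod_ne_zero_iff.mpr hne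
  have hpow : (n : ℂ) ^ s * (n.factorial : ℂ) ≠ 0 :=
    mul_ne_zero (by simp [Complex.cpow_eq_zero_iff, hn']) (by exact_mod_cast n.factorial_ne_zero)
  unfold Complex.GammaSeq
  refine ⟨hd1.div hd3 hne3, ?_⟩
  rw [logDeriv_div s hpow hne3 hd1 hd3,
    logDeriv_mul_const _ _ (by exact_mod_cast n.factorial_ne_zero)]
  congr 1
  · have h := ((hasDerivAt_id s).const_cpow (c := (n : ℂ)) (Or.inl hn')).deriv
    rw [logDeriv_apply]
    simp only [id] at h
    rw [h]
    have : (n : ℂ) ^ s ≠ 0 := by simp [Complex.cpow_eq_zero_iff, hn']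
    simp only [mul_one]
    rw [mul_div_cancel_left₀ _ this, Complex.natCast_log]
  · rw [logDeriv_prod hne hd2]
    refine Finset.sum_congr rfl fun j _ => ?_
    simp [logDeriv_apply]

theorem Complex.tendsto_digamma {s : ℂ} (hs : 0 < s.re) :
    Tendsto (fun n : ℕ => (Real.log n : ℂ) - ∑ j ∈ Finset.range (n + 1), 1 / (s + j)) atTop
      (𝓝 (Complex.digamma s)) := by
  have hU : IsOpen {w : ℂ | 0 < w.re} := isOpen_lt continuous_const Complex.continuous_re
  have hball : Metric.closedBall s (s.re / 2) ⊆ {w : ℂ | s.re / 2 ≤ w.re} := by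
    intro w hw
    have h1 := Complex.abs_re_le_norm (w - s)
    rw [mem_closedBall_iff_norm] at hw
    have h2 := (abs_le.mp (h1.trans hw)).1
    simp only [Complex.sub_re] at h2
    simp only [Set.mem_ofPred_eq]
    linarith
  have hcont : ContinuousOn (fun w : ℂ => Real.Gamma w.re) (Metric.sphere s (s.re / 2)) := by
    intro w hw
    have hw' : s.re / 2 ≤ w.re := hball (Metric.sphere_subset_closedBall hw)
    have : ContinuousAt Real.Gamma w.re :=
      (Real.differentiableAt_Gamma fun m hm => by
        have : (0 : ℝ) ≤ m := by positivity
        linarith).continuousAt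
    exact (this.comp (f := Complex.re) Complex.continuous_re.continuousAt).continuousWithinAt
  obtain ⟨C, hC⟩ := (isCompact_sphere s (s.re / 2)).bddAbove_image hcont
  have hderiv := tendsto_deriv_of_norm_le (f := fun n s => Complex.GammaSeq s n)
    (g := Complex.Gamma) (z := s) (r := s.re / 2) (C := C) hU (by linarith)
    (hball.trans fun w hw => lt_of_lt_of_le (by linarith : 0 < s.re / 2) hw)
    (by
      filter_upwards [eventually_ne_atTop 0] with n hn w hw
      exact (Complex.logDeriv_gammaSeq hw hn).1.differentiableWithinAt)
    (fun w hw => (Complex.differentiableAt_Gamma_of_re_pos hw).differentiableWithinAt)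
    (by
      filter_upwards [eventually_ne_atTop 0] with n hn w hw
      have hw' : s.re / 2 ≤ w.re := hball (Metric.sphere_subset_closedBall hw)
      exact (Complex.norm_gammaSeq_le (by linarith) hn).trans (hC ⟨w, hw, rfl⟩))
    (fun w _ => Complex.GammaSeq_tendsto_Gamma w)
  have hlim := hderiv.div (Complex.GammaSeq_tendsto_Gamma s) (Complex.Gamma_ne_zero_of_re_pos hs)
  refine hlim.congr' ?_
  filter_upwards [eventually_ne_atTop 0] with n hn
  exact (Complex.logDeriv_gammaSeq hs hn).2

theorem Complex.norm_digamma_sub_le {s c : ℂ} (hs : 1 ≤ s.re) (hc : 1 ≤ c.re) :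
    ‖Complex.digamma s - Complex.digamma c‖ ≤ 2 * ‖s - c‖ := by
  refine le_of_tendsto ((Complex.tendsto_digamma (by linarith : 0 < s.re)).sub
    (Complex.tendsto_digamma (by linarith : 0 < c.re))).norm (Eventually.of_forall fun n => ?_)
  have hsum : ∀ m : ℕ,
      ∑ j ∈ Finset.range (m + 1), 1 / ((j : ℝ) + 1) ^ 2 ≤ 2 - 1 / ((m : ℝ) + 1) := by
    intro m
    induction m with
    | zero => norm_num
    | succ m ih =>
      rw [Finset.sum_range_succ]
      have : 1 / ((m : ℝ) + 1 + 1) ^ 2 ≤ 1 / (m + 1) - 1 / (m + 1 + 1) := by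
        rw [div_sub_div _ _ (by positivity) (by positivity),
          div_le_div_iff₀ (by positivity) (by positivity)]
        ring_nf
        have : (0 : ℝ) ≤ m := by positivity
        nlinarith
      push_cast
      linarith
  rw [sub_sub_sub_cancel_left, ← Finset.sum_sub_distrib]
  calc _ ≤ ∑ j ∈ Finset.range (n + 1), 1 / ((j : ℝ) + 1) ^ 2 * ‖s - c‖ := by
        refine norm_sum_le_of_le _ fun j _ => ?_
        have h1 := Complex.add_natCast_ne_zero (by linarith : 0 < s.re) j
        have h2 := Complex.add_natCast_ne_zero (by linarith : 0 < c.re) j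
        have h3 : (j : ℝ) + 1 ≤ ‖s + j‖ := by linarith [Complex.re_add_natCast_le_norm s j]
        have h4 : (j : ℝ) + 1 ≤ ‖c + j‖ := by linarith [Complex.re_add_natCast_le_norm c j]
        have h5 : 1 / (c + j) - 1 / (s + j) = (s - c) / ((c + j) * (s + j)) := by
          field_simp; ring
        rw [h5, norm_div, norm_mul, sq, one_div_mul_eq_div]
        gcongr
    _ ≤ 2 * ‖s - c‖ := by
        rw [← Finset.sum_mul]
        have : (0 : ℝ) ≤ 1 / ((n : ℝ) + 1) := by positivity
        gcongr
        linarith [hsum n]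

theorem Complex.log_le_re_digamma {c : ℂ} (hc : 1 ≤ c.re) (hy : 0 < c.im) :
    Real.log c.im - 1 / 2 + (Complex.digamma 1).re ≤ (Complex.digamma c).re := by
  set y := c.im with hy_def
  set N := ⌊y⌋₊ with hN
  have h1 := (Complex.continuous_re.tendsto _).comp
    (Complex.tendsto_digamma (s := 1) (by simp))
  have h2 := (Complex.continuous_re.tendsto _).comp
    (Complex.tendsto_digamma (s := c) (by linarith))
  refine le_of_tendsto_of_tendsto (h1.const_add (Real.log y - 1 / 2)) h2 ?_
  filter_upwards [eventually_ge_atTop N] with n hn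
  simp only [Function.comp_apply, Complex.sub_re, Complex.re_sum, Complex.ofReal_re]
  have hre : ∀ j : ℕ, (1 / (c + j)).re = (c.re + j) / ((c.re + j) ^ 2 + y ^ 2) := by
    intro j
    simp only [one_div, Complex.inv_re, Complex.normSq_apply, Complex.add_re, Complex.natCast_re,
      Complex.add_im, Complex.natCast_im, add_zero, ← hy_def, sq]
  have hone : ∀ j : ℕ, (1 / ((1 : ℂ) + j)).re = 1 / (j + 1 : ℝ) := by
    intro j
    rw [add_comm, show ((j : ℂ) + 1) = ((j + 1 : ℝ) : ℂ) by push_cast; rfl, ← Complex.ofReal_one,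
      ← Complex.ofReal_div, Complex.ofReal_re]
  have hle : ∀ j : ℕ, (1 / (c + j)).re ≤ 1 / (j + 1 : ℝ) := by
    intro j
    rw [hre, div_le_div_iff₀ (by positivity) (by positivity)]
    have : (0 : ℝ) ≤ j := by positivity
    nlinarith [sq_nonneg y]
  have hle' : ∀ j : ℕ, (1 / (c + j)).re ≤ 1 / (2 * y) := by
    intro j
    rw [hre, div_le_div_iff₀ (by positivity) (by positivity)]
    nlinarith [sq_nonneg (c.re + j - y)]
  have hsplit : ∑ j ∈ Finset.range (n + 1), (1 / (c + j)).re ≤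
      N * (1 / (2 * y)) + ∑ j ∈ Finset.Ico N (n + 1), 1 / (j + 1 : ℝ) := by
    rw [← Finset.sum_range_add_sum_Ico _ (by omega : N ≤ n + 1)]
    refine add_le_add ?_ (Finset.sum_le_sum fun j _ => hle j)
    calc _ ≤ ∑ j ∈ Finset.range N, 1 / (2 * y) := Finset.sum_le_sum fun j _ => hle' j
      _ = _ := by simp
  have hharm : Real.log y ≤ ∑ j ∈ Finset.range N, 1 / (j + 1 : ℝ) := by
    have h := log_add_one_le_harmonic N
    have h' : Real.log y ≤ Real.log (N + 1 : ℕ) := by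
      apply Real.log_le_log hy
      push_cast
      exact (Nat.lt_floor_add_one y).le
    refine (h'.trans h).trans (le_of_eq ?_)
    simp [harmonic]
  have hNy : N * (1 / (2 * y)) ≤ 1 / 2 := by
    have := Nat.floor_le hy.le
    rw [mul_one_div, div_le_div_iff₀ (by positivity) (by positivity)]
    linarith
  have hsum1 : ∑ j ∈ Finset.range (n + 1), (1 / ((1 : ℂ) + j)).re =
      ∑ j ∈ Finset.range N, 1 / (j + 1 : ℝ) + ∑ j ∈ Finset.Ico N (n + 1), 1 / (j + 1 : ℝ) := by
    rw [Finset.sum_range_add_sum_Ico _ (by omega : N ≤ n + 1)]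
    exact Finset.sum_congr rfl fun j _ => hone j
  linarith

theorem Complex.norm_Gamma_mul_le {s : ℂ} {σ δ : ℝ} (hσ : 0 < σ) (hs : σ ≤ s.re) (hδ : 0 ≤ δ) :
    ‖Complex.Gamma s‖ * Real.Gamma (σ + δ) ≤ ‖Complex.Gamma (s + δ)‖ * Real.Gamma σ := by
  refine le_of_tendsto_of_tendsto
    ((Complex.GammaSeq_tendsto_Gamma s).norm.mul (Real.GammaSeq_tendsto_Gamma (σ + δ)))
    ((Complex.GammaSeq_tendsto_Gamma (s + δ)).norm.mul (Real.GammaSeq_tendsto_Gamma σ)) ?_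
  filter_upwards [eventually_ne_atTop 0] with n hn
  have hn' : (0 : ℝ) < n := by positivity
  have hnorm : ∀ w : ℂ, ‖Complex.GammaSeq w n‖ =
      (n : ℝ) ^ w.re * n.factorial / ∏ j ∈ Finset.range (n + 1), ‖w + j‖ := by
    intro w
    rw [Complex.GammaSeq, norm_div, norm_mul, norm_prod, Complex.norm_natCast,
      ← Complex.ofReal_natCast n, Complex.norm_cpow_eq_rpow_re_of_pos hn']
  have hnum : (n : ℝ) ^ s.re * n.factorial * ((n : ℝ) ^ (σ + δ) * n.factorial) =
      (n : ℝ) ^ (s + δ : ℂ).re * n.factorial * ((n : ℝ) ^ σ * n.factorial) := by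
    have h1 : (s + δ : ℂ).re = s.re + δ := by simp
    rw [h1, Real.rpow_add hn', Real.rpow_add hn']
    ring
  have hpos : ∀ w : ℂ, 0 < w.re → ∀ j : ℕ, 0 < ‖w + j‖ := fun w hw j =>
    norm_pos_iff.mpr (Complex.add_natCast_ne_zero hw j)
  have hsδ : 0 < (s + δ : ℂ).re := by simp; linarith
  rw [hnorm, hnorm, Real.GammaSeq, Real.GammaSeq, div_mul_div_comm, div_mul_div_comm, hnum,
    ← Finset.prod_mul_distrib, ← Finset.prod_mul_distrib]
  have hprod : 0 < ∏ j ∈ Finset.range (n + 1), (‖s + δ + j‖ * (σ + j)) :=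
    Finset.prod_pos fun j _ => mul_pos (hpos _ hsδ j) (by positivity)
  refine div_le_div_of_nonneg_left (by positivity) hprod
    (Finset.prod_le_prod (fun j _ => by positivity) fun j _ => ?_)
  have h1 : ‖s + δ + j‖ ≤ ‖s + j‖ + δ := by
    calc ‖s + δ + j‖ = ‖(s + j) + (δ : ℂ)‖ := by ring_nf
      _ ≤ ‖s + j‖ + ‖(δ : ℂ)‖ := norm_add_le _ _
      _ = _ := by rw [Complex.norm_real, Real.norm_of_nonneg hδ]
  have h2 := Complex.re_add_natCast_le_norm s j
  have hj0 : (0 : ℝ) ≤ j := by positivity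
  calc ‖s + δ + j‖ * (σ + j) ≤ (‖s + j‖ + δ) * (σ + j) := by gcongr
    _ ≤ ‖s + j‖ * (σ + δ + j) := by nlinarith

theorem Complex.norm_sin_le_exp (w : ℂ) : ‖Complex.sin w‖ ≤ Real.exp |w.im| := by
  rw [Complex.sin, norm_div, norm_mul, Complex.norm_I, mul_one, Complex.norm_two]
  have h1 : ‖Complex.exp (-w * Complex.I)‖ ≤ Real.exp |w.im| := by
    rw [Complex.norm_exp]
    exact Real.exp_le_exp.mpr (by simpa using le_abs_self _)
  have h2 : ‖Complex.exp (w * Complex.I)‖ ≤ Real.exp |w.im| := by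
    rw [Complex.norm_exp]
    exact Real.exp_le_exp.mpr (by simpa using neg_le_abs _)
  have := norm_sub_le (Complex.exp (-w * Complex.I)) (Complex.exp (w * Complex.I))
  linarith

theorem Complex.exp_le_norm_Gamma (u : ℝ) :
    1 / 2 * Real.exp (-(Real.pi * |u| / 2)) ≤ ‖Complex.Gamma (3 / 2 + u * Complex.I)‖ := by
  set z : ℂ := 1 / 2 + u * Complex.I with hz
  have hre : z.re = 1 / 2 := by simp [hz]
  have hz0 : z ≠ 0 := fun h => by simp [h] at hre
  have hsub : 1 - z = starRingEnd ℂ z := by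
    apply Complex.ext <;> simp [hz]; norm_num
  have hrefl := congrArg norm (Complex.Gamma_mul_Gamma_one_sub z)
  rw [hsub, Complex.Gamma_conj, norm_mul, Complex.norm_conj, norm_div] at hrefl
  have hsin := Complex.norm_sin_le_exp (Real.pi * z)
  have him : (Real.pi * z : ℂ).im = Real.pi * u := by simp [hz]
  rw [him, abs_mul, abs_of_pos Real.pi_pos] at hsin
  have hΓ : 0 < ‖Complex.Gamma z‖ :=
    norm_pos_iff.mpr (Complex.Gamma_ne_zero_of_re_pos (by rw [hre]; norm_num))
  have hsin_pos : 0 < ‖Complex.sin (Real.pi * z)‖ := by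
    rcases (norm_nonneg (Complex.sin (Real.pi * z))).eq_or_lt with h | h
    · rw [← h, div_zero] at hrefl
      nlinarith
    · exact h
  have hlow : Real.exp (-(Real.pi * |u|)) ≤ ‖Complex.Gamma z‖ * ‖Complex.Gamma z‖ := by
    rw [hrefl, Complex.norm_real, Real.norm_of_nonneg Real.pi_pos.le, Real.exp_neg, inv_eq_one_div]
    have := Real.pi_gt_three
    gcongr
    linarith
  have hsqrt : Real.exp (-(Real.pi * |u| / 2)) ≤ ‖Complex.Gamma z‖ := by
    refine abs_le_of_sq_le_sq' ?_ hΓ.le |>.2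
    rw [← Real.exp_nat_mul, sq]
    refine le_trans (le_of_eq ?_) hlow
    congr 1
    push_cast
    ring
  have hadd : Complex.Gamma (3 / 2 + u * Complex.I) = z * Complex.Gamma z := by
    rw [← Complex.Gamma_add_one z hz0]
    congr 1
    rw [hz]; ring
  rw [hadd, norm_mul]
  have : 1 / 2 ≤ ‖z‖ := by rw [← hre]; exact Complex.re_le_norm z
  gcongr

theorem norm_mellin_le {f : ℝ → ℂ} {a b : ℝ} (ha : MellinConvergent f a)
    (hb : MellinConvergent f b) :
    ∃ C, ∀ s : ℂ, a ≤ s.re → s.re ≤ b → ‖mellin f s‖ ≤ C := by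
  refine ⟨∫ x in Set.Ioi (0 : ℝ), (‖(x : ℂ) ^ ((a : ℂ) - 1) • f x‖ +
    ‖(x : ℂ) ^ ((b : ℂ) - 1) • f x‖), fun s hsa hsb => ?_⟩
  refine MeasureTheory.norm_integral_le_of_norm_le (ha.norm.add hb.norm) ?_
  filter_upwards [MeasureTheory.ae_restrict_mem measurableSet_Ioi] with x hx
  have hx' : (0 : ℝ) < x := hx
  simp only [norm_smul, Complex.norm_cpow_eq_rpow_re_of_pos hx', Complex.sub_re, Complex.one_re,
    Complex.ofReal_re]
  rw [← add_mul]
  refine mul_le_mul_of_nonneg_right ?_ (norm_nonneg _)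
  rcases le_total x 1 with h | h
  · have := Real.rpow_le_rpow_of_exponent_ge hx' h (by linarith : a - 1 ≤ s.re - 1)
    have := Real.rpow_nonneg hx'.le (b - 1)
    linarith
  · have := Real.rpow_le_rpow_of_exponent_le h (by linarith : s.re - 1 ≤ b - 1)
    have := Real.rpow_nonneg hx'.le (a - 1)
    linarith

theorem mellin_conj {f : ℝ → ℂ} (hf : ∀ x > 0, starRingEnd ℂ (f x) = f x) (s : ℂ) :
    mellin f (starRingEnd ℂ s) = starRingEnd ℂ (mellin f s) := by
  unfold mellin
  rw [← integral_conj]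
  refine MeasureTheory.setIntegral_congr_fun measurableSet_Ioi fun x hx => ?_
  have hx' : (0 : ℝ) < x := hx
  have harg : (x : ℂ).arg ≠ Real.pi := by
    rw [Complex.arg_ofReal_of_nonneg hx'.le]; exact Real.pi_ne_zero.symm
  have := Complex.cpow_conj (x : ℂ) (s - 1) harg
  simp only [map_sub, map_one, Complex.conj_ofReal] at this
  simp only [smul_eq_mul, map_mul, hf x hx', this]

theorem completedRiemannZeta₀_eq_mellin (s : ℂ) : completedRiemannZeta₀ s =
    mellin (HurwitzZeta.hurwitzEvenFEPair 0).f_modif (s / 2) / 2 := rfl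

theorem completedRiemannZeta₀_conj (s : ℂ) :
    completedRiemannZeta₀ (starRingEnd ℂ s) = starRingEnd ℂ (completedRiemannZeta₀ s) := by
  have h : starRingEnd ℂ s / 2 = starRingEnd ℂ (s / 2) := by simp [Complex.conj_ofNat]
  rw [completedRiemannZeta₀_eq_mellin, completedRiemannZeta₀_eq_mellin, h, mellin_conj]
  · simp [Complex.conj_ofNat]
  · intro x _
    simp only [WeakFEPair.f_modif, HurwitzZeta.hurwitzEvenFEPair, Pi.add_apply, map_add,
      Set.indicator]
    congr 1 <;> split_ifs <;> simp

theorem norm_completedRiemannZeta₀_le (a b : ℝ) :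
    ∃ C, ∀ s : ℂ, a ≤ s.re → s.re ≤ b → ‖completedRiemannZeta₀ s‖ ≤ C := by
  have hconv : ∀ s : ℂ, MellinConvergent (HurwitzZeta.hurwitzEvenFEPair 0).f_modif s := fun s =>
    ((HurwitzZeta.hurwitzEvenFEPair 0).isStrongFEPair_toStrongFEPair.hasMellin s).1
  obtain ⟨C, hC⟩ := norm_mellin_le (hconv (a / 2 : ℝ)) (hconv (b / 2 : ℝ))
  refine ⟨C / 2, fun s hsa hsb => ?_⟩
  have hre : (s / 2).re = s.re / 2 := by simp
  rw [completedRiemannZeta₀_eq_mellin, norm_div, Complex.norm_two]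
  gcongr
  exact hC _ (by rw [hre]; linarith) (by rw [hre]; linarith)

/-- The entire function `s (1 - s) Λ(s)`, where `Λ` is the completed Riemann zeta function. -/
noncomputable def entireXi (s : ℂ) : ℂ := s * (1 - s) * completedRiemannZeta₀ s - 1

theorem differentiable_entireXi : Differentiable ℂ entireXi := by
  have := differentiable_completedZeta₀
  unfold entireXi
  fun_prop

theorem entireXi_one_sub (s : ℂ) : entireXi (1 - s) = entireXi s := by
  rw [entireXi, entireXi, completedRiemannZeta₀_one_sub]
  ring

theorem entireXi_conj (s : ℂ) : entireXi (starRingEnd ℂ s) = starRingEnd ℂ (entireXi s) := by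
  simp [entireXi, completedRiemannZeta₀_conj]

theorem entireXi_eq_completedRiemannZeta {s : ℂ} (hs : s ≠ 0) (hs_one : s ≠ 1) :
    entireXi s = s * (1 - s) * completedRiemannZeta s := by
  have : 1 - s ≠ 0 := sub_ne_zero.mpr hs_one.symm
  rw [entireXi, completedRiemannZeta_eq]
  field_simp
  ring

theorem entireXi_eq_riemannZeta {s : ℂ} (hs : 0 < s.re) (hs_one : s ≠ 1) :
    entireXi s = s * (1 - s) * (Complex.Gammaℝ s * riemannZeta s) := by
  have h0 : s ≠ 0 := fun h => by simp [h] at hs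
  rw [entireXi_eq_completedRiemannZeta h0 hs_one, riemannZeta_def_of_ne_zero h0,
    mul_div_cancel₀ _ (Complex.Gammaℝ_ne_zero_of_re_pos hs)]

theorem entireXi_one : entireXi 1 = -1 := by simp [entireXi]

theorem norm_entireXi_le (a b : ℝ) :
    ∃ C > 0, ∀ s : ℂ, a ≤ s.re → s.re ≤ b → ‖entireXi s‖ ≤ C * (1 + ‖s‖) ^ 2 := by
  obtain ⟨C, hC⟩ := norm_completedRiemannZeta₀_le a b
  refine ⟨|C| + 1, by positivity, fun s hsa hsb => ?_⟩
  have h1 : ‖completedRiemannZeta₀ s‖ ≤ |C| := (hC s hsa hsb).trans (le_abs_self C)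
  have h2 : ‖(1 : ℂ) - s‖ ≤ 1 + ‖s‖ := by simpa using norm_sub_le (1 : ℂ) s
  have h3 : ‖s‖ ≤ 1 + ‖s‖ := by linarith
  have h4 : 0 ≤ ‖s‖ := norm_nonneg s
  calc ‖entireXi s‖ ≤ ‖s * (1 - s) * completedRiemannZeta₀ s‖ + ‖(1 : ℂ)‖ := norm_sub_le _ _
    _ = ‖s‖ * ‖1 - s‖ * ‖completedRiemannZeta₀ s‖ + 1 := by simp
    _ ≤ (1 + ‖s‖) * (1 + ‖s‖) * |C| + (1 + ‖s‖) ^ 2 := by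
        gcongr
        nlinarith
    _ = _ := by ring

theorem RiemannHypothesis.entireXi_ne_zero (RH : RiemannHypothesis) {s : ℂ} (hs : 1 / 2 < s.re) :
    entireXi s ≠ 0 := by
  by_cases h1 : s = 1
  · rw [h1, entireXi_one]; norm_num
  have hre : 0 < s.re := by linarith
  rw [entireXi_eq_riemannZeta hre h1]
  refine mul_ne_zero (mul_ne_zero (fun h => by simp [h] at hre) (sub_ne_zero.mpr (Ne.symm h1)))
    (mul_ne_zero (Complex.Gammaℝ_ne_zero_of_re_pos hre) fun hz => ?_)
  have := RH s hz ?_ h1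
  · linarith
  · rintro ⟨n, rfl⟩
    simp at hre
    have : (0 : ℝ) ≤ n := by positivity
    linarith

theorem conj_one_half_add_I_mul (t : ℝ) :
    starRingEnd ℂ (1 / 2 + Complex.I * t) = 1 - (1 / 2 + Complex.I * t) := by
  apply Complex.ext <;> simp
  norm_num

theorem entireXi_im_eq_zero (t : ℝ) : (entireXi (1 / 2 + Complex.I * t)).im = 0 := by
  rw [← Complex.conj_eq_iff_im, ← entireXi_conj, conj_one_half_add_I_mul, entireXi_one_sub]

theorem hardyZ_mul_eq (t : ℝ) :
    hardyZ t * ((1 / 4 + t ^ 2) * ‖Complex.Gamma (1 / 4 + Complex.I * t / 2)‖) =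
      Real.pi ^ (1 / 4 : ℝ) * (entireXi (1 / 2 + Complex.I * t)).re := by
  set s : ℂ := 1 / 2 + Complex.I * t with hs
  set G := Complex.Gamma (1 / 4 + Complex.I * t / 2) with hG
  have hre : s.re = 1 / 2 := by simp [hs]
  have hs1 : s ≠ 1 := fun h => by rw [h] at hre; norm_num at hre
  have hG0 : G ≠ 0 := Complex.Gamma_ne_zero_of_re_pos (by simp)
  have hsG : s / 2 = 1 / 4 + Complex.I * t / 2 := by rw [hs]; ring
  have hpi : (Real.pi : ℂ) ≠ 0 := by exact_mod_cast Real.pi_ne_zero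
  have hexp : Complex.exp (Complex.I * theta t) * ‖G‖ =
      (Real.pi ^ (1 / 4 : ℝ) : ℝ) * Complex.Gammaℝ s := by
    have h1 : Complex.exp (Complex.log G) = G := Complex.exp_log hG0
    have h2 : (‖G‖ : ℂ) = Complex.exp (Complex.log G).re := by
      rw [← Complex.ofReal_exp, Complex.log_re, Real.exp_log (norm_pos_iff.mpr hG0)]
    rw [Complex.Gammaℝ_def, hsG, ← hG, h2, Complex.ofReal_cpow Real.pi_pos.le,
      ← mul_assoc, ← Complex.cpow_add _ _ hpi, Complex.cpow_def_of_ne_zero hpi]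
    have h3 : G = Complex.exp ((Complex.log G).re + (Complex.log G).im * Complex.I) := by
      rw [Complex.re_add_im, h1]
    refine Eq.trans ?_ (congrArg _ h3.symm)
    rw [← Complex.exp_add, ← Complex.exp_add, theta, ← hG, ← Complex.ofReal_log Real.pi_pos.le]
    congr 1
    rw [hs]
    push_cast
    ring
  have hquad : s * (1 - s) = ((1 / 4 + t ^ 2 : ℝ) : ℂ) := by
    rw [hs]
    push_cast
    linear_combination -(t : ℂ) ^ 2 * Complex.I_sq
  have hX : entireXi s = ((1 / 4 + t ^ 2 : ℝ) : ℂ) * (Complex.Gammaℝ s * riemannZeta s) := by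
    rw [entireXi_eq_riemannZeta (by rw [hre]; norm_num) hs1, hquad]
  have hfinal : (Complex.exp (Complex.I * theta t) * riemannZeta s) *
      (((1 / 4 + t ^ 2) * ‖G‖ : ℝ) : ℂ) = ((Real.pi ^ (1 / 4 : ℝ) : ℝ) : ℂ) * entireXi s := by
    rw [hX, Complex.ofReal_mul]
    linear_combination ((1 / 4 + t ^ 2 : ℝ) : ℂ) * riemannZeta s * hexp
  have := congrArg Complex.re hfinal
  rw [Complex.re_mul_ofReal, Complex.re_ofReal_mul] at this
  exact this

theorem norm_Gamma_quarter_pos (t : ℝ) : 0 < ‖Complex.Gamma (1 / 4 + Complex.I * t / 2)‖ :=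
  norm_pos_iff.mpr (Complex.Gamma_ne_zero_of_re_pos (by simp))

theorem hardyZ_eq_zero_iff (t : ℝ) :
    hardyZ t = 0 ↔ entireXi (1 / 2 + Complex.I * t) = 0 := by
  have h := hardyZ_mul_eq t
  have hG := norm_Gamma_quarter_pos t
  have h2 : (0 : ℝ) < Real.pi ^ (1 / 4 : ℝ) := by positivity
  have h3 : 0 < (1 / 4 + t ^ 2) * ‖Complex.Gamma (1 / 4 + Complex.I * t / 2)‖ := by positivity
  constructor
  · intro h0
    rw [h0, zero_mul, eq_comm, mul_eq_zero] at h
    exact Complex.ext (h.resolve_left h2.ne') (entireXi_im_eq_zero t)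
  · intro h0
    rw [h0, Complex.zero_re, mul_zero, mul_eq_zero] at h
    exact h.resolve_right h3.ne'

theorem analyticAt_re_comp_ofReal {f : ℂ → ℂ} {c d : ℂ} {t : ℝ}
    (hf : AnalyticAt ℂ f (c + d * t)) :
    AnalyticAt ℝ (fun u : ℝ => (f (c + d * u)).re) t ∧
      AnalyticAt ℝ (fun u : ℝ => (f (c + d * u)).im) t := by
  have hlin : AnalyticAt ℂ (fun z : ℂ => c + d * z) (t : ℂ) := by fun_prop
  have h : AnalyticAt ℂ (fun z : ℂ => f (c + d * z)) (t : ℂ) :=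
    AnalyticAt.fun_comp (g := f) (f := fun z : ℂ => c + d * z) hf hlin
  exact ⟨h.re_ofReal, h.im_ofReal⟩

theorem analyticOnNhd_hardyZ : AnalyticOnNhd ℝ hardyZ Set.univ := by
  intro t _
  have hG := analyticAt_re_comp_ofReal (f := Complex.Gamma) (c := 1 / 4) (d := Complex.I / 2)
    (t := t) (by
      refine DifferentiableOn.analyticAt (s := {z : ℂ | 0 < z.re})
        (fun z hz => (Complex.differentiableAt_Gamma_of_re_pos hz).differentiableWithinAt) ?_
      exact (isOpen_lt continuous_const Complex.continuous_re).mem_nhds (by simp))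
  have hX := (analyticAt_re_comp_ofReal (f := entireXi) (c := 1 / 2) (d := Complex.I) (t := t)
    (differentiable_entireXi.analyticAt _)).1
  have hnorm : ∀ u : ℝ, ‖Complex.Gamma (1 / 4 + Complex.I * u / 2)‖ =
      Real.exp (Real.log ((Complex.Gamma (1 / 4 + Complex.I / 2 * u)).re ^ 2 +
        (Complex.Gamma (1 / 4 + Complex.I / 2 * u)).im ^ 2) / 2) := by
    intro u
    have h : Complex.I * u / 2 = Complex.I / 2 * u := by ring
    have hpos := norm_Gamma_quarter_pos u
    rw [h] at hpos ⊢
    have h2 : (Complex.Gamma (1 / 4 + Complex.I / 2 * u)).re ^ 2 +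
        (Complex.Gamma (1 / 4 + Complex.I / 2 * u)).im ^ 2 =
        ‖Complex.Gamma (1 / 4 + Complex.I / 2 * u)‖ ^ 2 := by
      rw [← Complex.normSq_eq_norm_sq, Complex.normSq_apply]; ring
    rw [h2, Real.log_pow, Nat.cast_ofNat, mul_div_cancel_left₀ _ two_ne_zero, Real.exp_log hpos]
  have heq : hardyZ = fun u : ℝ => Real.pi ^ (1 / 4 : ℝ) *
      (entireXi (1 / 2 + Complex.I * u)).re / ((1 / 4 + u ^ 2) *
        Real.exp (Real.log ((Complex.Gamma (1 / 4 + Complex.I / 2 * u)).re ^ 2 +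
        (Complex.Gamma (1 / 4 + Complex.I / 2 * u)).im ^ 2) / 2)) := by
    ext u
    rw [eq_div_iff (by positivity), ← hnorm, hardyZ_mul_eq]
  rw [heq]
  have hpos : 0 < (Complex.Gamma (1 / 4 + Complex.I / 2 * t)).re ^ 2 +
      (Complex.Gamma (1 / 4 + Complex.I / 2 * t)).im ^ 2 := by
    have h : Complex.Gamma (1 / 4 + Complex.I / 2 * t) ≠ 0 :=
      Complex.Gamma_ne_zero_of_re_pos (by simp)
    have := Complex.normSq_pos.mpr h
    rw [Complex.normSq_apply] at this
    linarith
  refine (analyticAt_const.mul hX).div ((analyticAt_const.add (analyticAt_id.pow 2)).mul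
    ((((hG.1.pow 2).add (hG.2.pow 2)).log hpos).div analyticAt_const two_ne_zero).rexp') ?_
  have := Real.exp_pos (Real.log ((Complex.Gamma (1 / 4 + Complex.I / 2 * t)).re ^ 2 +
      (Complex.Gamma (1 / 4 + Complex.I / 2 * t)).im ^ 2) / 2)
  positivity

theorem hardyZ_ne_zero : hardyZ ≠ 0 := by
  intro h
  have hline : ∀ t : ℝ, entireXi (1 / 2 + Complex.I * t) = 0 := fun t =>
    (hardyZ_eq_zero_iff t).mp (by rw [h]; rfl)
  have han : AnalyticOnNhd ℂ entireXi Set.univ := fun z _ => differentiable_entireXi.analyticAt z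
  have hfreq : ∃ᶠ z in 𝓝[≠] (1 / 2 : ℂ), entireXi z = 0 := by
    have htend : Tendsto (fun t : ℝ => (1 / 2 + Complex.I * t : ℂ)) (𝓝[≠] 0) (𝓝[≠] (1 / 2)) := by
      refine tendsto_nhdsWithin_of_tendsto_nhds_of_eventually_within _ ?_ ?_
      · have hc : Continuous fun t : ℝ => (1 / 2 + Complex.I * t : ℂ) := by fun_prop
        simpa using (hc.tendsto 0).mono_left nhdsWithin_le_nhds
      · filter_upwards [self_mem_nhdsWithin] with t ht
        simpa using ht
    exact htend.frequently (Eventually.of_forall hline).frequently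
  have := han.eqOn_zero_of_preconnected_of_frequently_eq_zero isPreconnected_univ
    (Set.mem_univ _) hfreq (Set.mem_univ 1)
  rw [entireXi_one] at this
  norm_num at this

theorem LSeriesSummable.norm_LSeries_le {f : ℕ → ℂ} {s₀ : ℂ} (hf : LSeriesSummable f s₀) :
    ∃ C > 0, ∀ s : ℂ, s₀.re ≤ s.re → ‖LSeries f s‖ ≤ C := by
  refine ⟨∑' n, ‖LSeries.term f s₀ n‖ + 1,
    add_pos_of_nonneg_of_pos (tsum_nonneg fun _ ↦ norm_nonneg _) one_pos, fun s hs ↦ ?_⟩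
  exact (tsum_of_norm_bounded (summable_norm_iff.mpr hf).hasSum
    fun n ↦ LSeries.norm_term_le_of_re_le_re f hs n).trans (le_add_of_nonneg_right zero_le_one)

theorem norm_riemannZeta_le : ∃ C > 0, ∀ s : ℂ, 2 ≤ s.re → ‖riemannZeta s‖ ≤ C := by
  obtain ⟨C, hC, h⟩ := (LSeriesSummable_one_iff (s := 2).mpr (by norm_num)).norm_LSeries_le
  refine ⟨C, hC, fun s hs ↦ ?_⟩
  rw [← LSeries_one_eq_riemannZeta (by linarith)]
  exact h s hs

theorem le_norm_riemannZeta : ∃ c > 0, ∀ s : ℂ, 2 ≤ s.re → c ≤ ‖riemannZeta s‖ := by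
  obtain ⟨C, hC, h⟩ := (ArithmeticFunction.LSeriesSummable_moebius_iff (s := 2).mpr
    (by norm_num)).norm_LSeries_le
  refine ⟨C⁻¹, by positivity, fun s hs ↦ ?_⟩
  have hmul := LSeries_one_mul_Lseries_moebius (s := s) (by linarith)
  rw [← LSeries_one_eq_riemannZeta (by linarith), eq_inv_of_mul_eq_one_left hmul, norm_inv]
  exact inv_anti₀ (norm_pos_iff.mpr (right_ne_zero_of_mul_eq_one hmul)) (h s hs)

theorem norm_logDeriv_riemannZeta_le :
    ∃ C > 0, ∀ s : ℂ, 2 ≤ s.re → ‖logDeriv riemannZeta s‖ ≤ C := by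
  obtain ⟨C, hC, h⟩ := (ArithmeticFunction.LSeriesSummable_vonMangoldt (s := 2)
    (by norm_num)).norm_LSeries_le
  refine ⟨C, hC, fun s hs ↦ ?_⟩
  rw [logDeriv_apply, ← norm_neg, ← neg_div,
    ← ArithmeticFunction.LSeries_vonMangoldt_eq_deriv_riemannZeta_div (by linarith)]
  exact h s hs

theorem norm_entireXi_eq {s : ℂ} (hs : 1 < s.re) :
    ‖entireXi s‖ = ‖s‖ * ‖1 - s‖ * (Real.pi ^ (-s.re / 2) * ‖Complex.Gamma (s / 2)‖ *
      ‖riemannZeta s‖) := by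
  have h₁ : s ≠ 1 := by rintro rfl; simp at hs
  rw [entireXi_eq_riemannZeta (by linarith) h₁, Complex.Gammaℝ_def, norm_mul, norm_mul, norm_mul,
    norm_mul, Complex.norm_cpow_eq_rpow_re_of_pos Real.pi_pos]
  congr 4
  have : (-s / 2).re = -s.re / 2 := by
    rw [show (2 : ℂ) = ((2 : ℝ) : ℂ) by norm_num, Complex.div_ofReal_re, Complex.neg_re]
  rw [this]

theorem exp_le_norm_entireXi :
    ∃ c > 0, ∀ y : ℝ, c * Real.exp (-|y|) ≤ ‖entireXi (3 + y * Complex.I)‖ := by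
  obtain ⟨c, hc, hζ⟩ := le_norm_riemannZeta
  refine ⟨3 * 2 * (Real.pi ^ (-3 / 2 : ℝ) * (1 / 2) * c), by positivity, fun y ↦ ?_⟩
  rw [norm_entireXi_eq (by simp)]
  have h₁ : 3 ≤ ‖(3 + y * Complex.I : ℂ)‖ := by
    simpa using Complex.re_le_norm (3 + y * Complex.I : ℂ)
  have h₂ : 2 ≤ ‖1 - (3 + y * Complex.I : ℂ)‖ := by
    rw [norm_sub_rev]
    refine le_trans ?_ (Complex.re_le_norm _)
    norm_num
  have h₃ := Complex.exp_le_norm_Gamma (y / 2)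
  have h₄ := hζ (3 + y * Complex.I) (by simp; norm_num)
  have h₅ : (3 + y * Complex.I : ℂ) / 2 = 3 / 2 + (y / 2 : ℝ) * Complex.I := by
    push_cast; ring
  have h₆ : Real.exp (-|y|) ≤ Real.exp (-(Real.pi * |y / 2| / 2)) := by
    rw [Real.exp_le_exp, abs_div, abs_two]
    nlinarith [abs_nonneg y, Real.pi_le_four]
  have h₇ : (3 + y * Complex.I : ℂ).re = 3 := by simp
  rw [h₅, h₇]
  calc _ = 3 * 2 * (Real.pi ^ (-3 / 2 : ℝ) * (1 / 2 * Real.exp (-|y|)) * c) := by ring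
    _ ≤ _ := by
      gcongr
      exact le_trans (by gcongr) h₃

theorem RiemannHypothesis.exp_le_norm_entireXi (RH : RiemannHypothesis) {η : ℝ} (hη : 0 < η) :
    ∃ A > 0, ∀ s : ℂ, 1 / 2 + η ≤ s.re → s.re ≤ 3 →
      Real.exp (-(A * (1 + |s.im|))) ≤ ‖entireXi s‖ := by
  obtain ⟨c, hc, hX⟩ := _root_.exp_le_norm_entireXi
  obtain ⟨C, hC, hX'⟩ := norm_entireXi_le (1 / 2) (11 / 2)
  obtain ⟨N, hN, hCN⟩ : ∃ N > 0, C * 2 * Real.exp 7 ≤ c * Real.exp N := by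
    refine ⟨|Real.log (C * 2 * Real.exp 7 / c)| + 1, by positivity, ?_⟩
    rw [← div_le_iff₀' hc, ← Real.log_le_iff_le_exp (by positivity)]
    exact (le_abs_self _).trans (le_add_of_nonneg_right zero_le_one)
  obtain ⟨N', hN', hcN'⟩ : ∃ N' > 0, Real.exp (-N') ≤ c := by
    refine ⟨|Real.log c| + 1, by positivity, ?_⟩
    rw [← Real.le_log_iff_exp_le hc]
    linarith [neg_abs_le (Real.log c)]
  refine ⟨N' + 1 + 5 * (N + 2) / η, by positivity, fun s hs hs' ↦ ?_⟩
  set y := s.im with hy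
  have hsc : ‖s - (3 + y * Complex.I)‖ = 3 - s.re := by
    have : s - (3 + y * Complex.I) = -((3 - s.re : ℝ) : ℂ) := by
      apply Complex.ext <;> simp [hy]
    rw [this, norm_neg, Complex.norm_of_nonneg (by linarith)]
  have hre : ∀ z ∈ Metric.ball (3 + y * Complex.I) (5 / 2), |z.re - 3| < 5 / 2 := by
    intro z hz
    rw [mem_ball_iff_norm] at hz
    refine lt_of_le_of_lt ?_ hz
    simpa using Complex.abs_re_le_norm (z - (3 + y * Complex.I))
  have key := norm_ge_of_ne_zero_on_ball (F := entireXi) (c := 3 + y * Complex.I) (R := 5 / 2)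
    (M := N + 2 * |y|) (by norm_num) (by positivity) differentiable_entireXi.differentiableOn
    (fun z hz ↦ RH.entireXi_ne_zero (by linarith [(abs_lt.mp (hre z hz)).1])) ?_ (z := s) ?_
  · refine le_trans ?_ key
    rw [hsc]
    have h₁ : 2 * (N + 2 * |y|) * (3 - s.re) / (5 / 2 - (3 - s.re)) ≤
        5 * (N + 2) / η * (1 + |y|) := by
      rw [div_mul_eq_mul_div]
      apply div_le_div₀ (by positivity) _ hη (by linarith)
      have := abs_nonneg y
      calc 2 * (N + 2 * |y|) * (3 - s.re) ≤ 2 * (N + 2 * |y|) * (5 / 2) := by gcongr; linarith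
        _ ≤ _ := by nlinarith
    calc Real.exp (-((N' + 1 + 5 * (N + 2) / η) * (1 + |y|)))
        ≤ Real.exp (-N' + -|y| + -(2 * (N + 2 * |y|) * (3 - s.re) / (5 / 2 - (3 - s.re)))) := by
          rw [Real.exp_le_exp]
          nlinarith [abs_nonneg y]
      _ = Real.exp (-N') * Real.exp (-|y|) *
          Real.exp (-(2 * (N + 2 * |y|) * (3 - s.re) / (5 / 2 - (3 - s.re)))) := by
          rw [Real.exp_add, Real.exp_add]
      _ ≤ _ := by
          gcongr
          exact le_trans (by gcongr) (hX y)
  · intro z hz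
    have hz' := abs_lt.mp (hre z hz)
    have hzn : ‖z‖ ≤ 6 + |y| := by
      rw [mem_ball_iff_norm] at hz
      calc ‖z‖ = ‖(z - (3 + y * Complex.I)) + 3 + y * Complex.I‖ := by ring_nf
        _ ≤ ‖z - (3 + y * Complex.I)‖ + ‖(3 : ℂ)‖ + ‖y * Complex.I‖ := norm_add₃_le
        _ ≤ 6 + |y| := by simp; linarith
    have h₀ : 0 ≤ 7 + |y| := by positivity
    calc ‖entireXi z‖ ≤ C * (1 + ‖z‖) ^ 2 := hX' z (by linarith) (by linarith)
      _ ≤ C * (7 + |y|) ^ 2 := by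
        have : 1 + ‖z‖ ≤ 7 + |y| := by linarith
        gcongr
      _ ≤ C * (2 * Real.exp (7 + |y|)) := by
        gcongr
        nlinarith [Real.quadratic_le_exp_of_nonneg h₀]
      _ = C * 2 * Real.exp 7 * Real.exp |y| := by rw [Real.exp_add]; ring
      _ ≤ c * Real.exp N * Real.exp |y| := by gcongr
      _ = c * Real.exp (-|y|) * Real.exp (N + 2 * |y|) := by
        rw [mul_assoc, mul_assoc, ← Real.exp_add, ← Real.exp_add]; ring_nf
      _ ≤ _ := by gcongr; exact hX y
  · rw [mem_ball_iff_norm, hsc]; linarith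

theorem norm_entireXi_le_mul_norm_add {a : ℝ} (ha : 0 ≤ a) :
    ∃ K > 0, ∀ s : ℂ, 2 ≤ s.re → ‖entireXi s‖ ≤ K * ‖entireXi (s + a)‖ := by
  obtain ⟨C, hC, hζ⟩ := norm_riemannZeta_le
  obtain ⟨c, hc, hζ'⟩ := le_norm_riemannZeta
  have hG : 0 < Real.Gamma (1 + a / 2) := Real.Gamma_pos_of_pos (by positivity)
  refine ⟨Real.pi ^ (a / 2) * (1 / Real.Gamma (1 + a / 2)) * (C / c), by positivity,
    fun s hs ↦ ?_⟩
  have hre : (s + a).re = s.re + a := by simp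
  rw [norm_entireXi_eq (by linarith), norm_entireXi_eq (by linarith)]
  have mono : ∀ w : ℂ, 0 ≤ w.re → ‖w‖ ≤ ‖w + a‖ := by
    intro w hw
    rw [Complex.norm_def, Complex.norm_def]
    apply Real.sqrt_le_sqrt
    simp only [Complex.normSq_apply, Complex.add_re, Complex.add_im, Complex.ofReal_re,
      Complex.ofReal_im]
    nlinarith [mul_nonneg hw ha]
  have h₁ := mono s (by linarith)
  have h₂ : ‖1 - s‖ ≤ ‖1 - (s + a)‖ := by
    rw [norm_sub_rev, norm_sub_rev 1 (s + a)]
    rw [add_sub_right_comm]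
    exact mono (s - 1) (by simp; linarith)
  have h₃ : ‖Complex.Gamma (s / 2)‖ ≤ 1 / Real.Gamma (1 + a / 2) *
      ‖Complex.Gamma ((s + a) / 2)‖ := by
    have := Complex.norm_Gamma_mul_le (s := s / 2) (σ := 1) (δ := a / 2) one_pos
      (by rw [show (2 : ℂ) = ((2 : ℝ) : ℂ) by norm_num, Complex.div_ofReal_re]; linarith)
      (by positivity)
    rw [one_div_mul_eq_div, le_div_iff₀ hG]
    refine this.trans_eq ?_
    rw [Real.Gamma_one, mul_one]
    congr 2
    push_cast
    ring
  have h₄ : ‖riemannZeta s‖ ≤ C / c * ‖riemannZeta (s + a)‖ := by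
    rw [div_mul_eq_mul_div, le_div_iff₀ hc]
    exact mul_le_mul (hζ s hs) (hζ' _ (by linarith)) hc.le hC.le
  have h₅ : Real.pi ^ (-s.re / 2) = Real.pi ^ (a / 2) * Real.pi ^ (-(s + a).re / 2) := by
    rw [← Real.rpow_add Real.pi_pos, hre]
    ring_nf
  rw [h₅]
  calc _ ≤ ‖s + a‖ * ‖1 - (s + a)‖ * (Real.pi ^ (a / 2) * Real.pi ^ (-(s + a).re / 2) *
        (1 / Real.Gamma (1 + a / 2) * ‖Complex.Gamma ((s + a) / 2)‖) *
        (C / c * ‖riemannZeta (s + a)‖)) := by gcongr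
    _ = _ := by ring

theorem HasDerivAt.nonneg_of_eventually_le {f : ℝ → ℝ} {f' x : ℝ} (hf : HasDerivAt f f' x)
    (h : ∀ᶠ y in 𝓝[>] x, f x ≤ f y) : 0 ≤ f' := by
  refine ge_of_tendsto (hf.tendsto_slope.mono_left (nhdsGT_le_nhdsNE x)) ?_
  filter_upwards [h, self_mem_nhdsWithin] with y hy hxy
  rw [slope_def_field]
  exact div_nonneg (sub_nonneg.mpr hy) (sub_nonneg.mpr (le_of_lt hxy))

theorem norm_entireXi_eq_norm_add {s : ℂ} {a : ℝ} (hs : s.re = (1 - a) / 2) :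
    ‖entireXi s‖ = ‖entireXi (s + a)‖ := by
  have : 1 - (s + a) = starRingEnd ℂ s := by
    apply Complex.ext
    · simp [hs]; ring
    · simp
  rw [← entireXi_one_sub (s + a), this, entireXi_conj, RCLike.norm_conj]

/-- On RH, `‖entireXi‖` increases away from the critical line. The quotient
`entireXi s / entireXi (s + a)` has modulus one on `re s = (1 - a) / 2`, so the Phragmén–Lindelöf
principle applies. -/
theorem RiemannHypothesis.norm_entireXi_le_norm_add (RH : RiemannHypothesis) {a : ℝ} (ha : 0 < a)
    (ha_one : a ≤ 1) {s : ℂ} (hs : (1 - a) / 2 ≤ s.re) : ‖entireXi s‖ ≤ ‖entireXi (s + a)‖ := by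
  set d : ℝ := (1 - a) / 2 with hd
  have hne : ∀ z : ℂ, 0 ≤ z.re → entireXi (z + d + a) ≠ 0 := fun z hz ↦
    RH.entireXi_ne_zero (by simp only [Complex.add_re, Complex.ofReal_re]; linarith)
  set Q : ℂ → ℂ := fun z ↦ entireXi (z + d) / entireXi (z + d + a) with hQ
  obtain ⟨K, hK, hX⟩ := norm_entireXi_le_mul_norm_add ha.le
  obtain ⟨A, hA, hX'⟩ := RH.exp_le_norm_entireXi (half_pos ha)
  obtain ⟨C, hC, hX''⟩ := norm_entireXi_le d 2
  have hQK : ∀ z : ℂ, 2 ≤ z.re → ‖Q z‖ ≤ K := by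
    intro z hz
    rw [hQ, norm_div, div_le_iff₀ (norm_pos_iff.mpr (hne z (by linarith)))]
    exact hX _ (by simp only [Complex.add_re, Complex.ofReal_re]; linarith)
  have hQA : ∀ z : ℂ, 0 ≤ z.re →
      ‖Q z‖ ≤ max K (C * 2 * Real.exp 2 * Real.exp A) * Real.exp ((A + 1) * ‖z‖) := by
    intro z hz
    have hone : 1 ≤ Real.exp ((A + 1) * ‖z‖) := Real.one_le_exp (by positivity)
    have hre : (z + d).re = z.re + d := by simp
    rcases le_total 2 (z + d).re with h | h
    · refine le_trans ?_ (le_mul_of_one_le_right (by positivity) hone)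
      refine le_max_of_le_left ?_
      rw [hQ, norm_div, div_le_iff₀ (norm_pos_iff.mpr (hne z (by linarith)))]
      exact hX _ h
    · have hn : 1 + ‖z + d‖ ≤ 2 + ‖z‖ := by
        have := norm_add_le z d
        rw [Complex.norm_of_nonneg (by linarith)] at this
        linarith
      have h₁ : ‖entireXi (z + d)‖ ≤ C * 2 * Real.exp 2 * Real.exp ‖z‖ := by
        have h₀ : 0 ≤ 2 + ‖z‖ := by positivity
        calc ‖entireXi (z + d)‖ ≤ C * (1 + ‖z + d‖) ^ 2 := hX'' _ (by linarith) h
          _ ≤ C * (2 + ‖z‖) ^ 2 := by gcongr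
          _ ≤ C * (2 * Real.exp (2 + ‖z‖)) := by
            gcongr
            nlinarith [Real.quadratic_le_exp_of_nonneg h₀]
          _ = _ := by rw [Real.exp_add]; ring
      have h₂ := hX' (z + d + a) (by simp; linarith) (by
        simp only [Complex.add_re, Complex.ofReal_re] at h ⊢; linarith)
      have h₃ : Real.exp (-(A * (1 + ‖z‖))) ≤ ‖entireXi (z + d + a)‖ := by
        refine le_trans ?_ h₂
        rw [Real.exp_le_exp, neg_le_neg_iff]
        gcongr
        simpa using Complex.abs_im_le_norm z
      rw [hQ, norm_div, div_le_iff₀ (norm_pos_iff.mpr (hne z hz))]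
      calc ‖entireXi (z + d)‖ ≤ C * 2 * Real.exp 2 * Real.exp ‖z‖ := h₁
        _ = C * 2 * Real.exp 2 * Real.exp A * Real.exp ((A + 1) * ‖z‖) *
            Real.exp (-(A * (1 + ‖z‖))) := by
          rw [mul_assoc (C * 2 * Real.exp 2), mul_assoc (C * 2 * Real.exp 2), ← Real.exp_add,
            ← Real.exp_add]
          ring_nf
        _ ≤ _ := by gcongr; exact le_max_right _ _
  have key : ‖Q (s - d)‖ ≤ 1 := by
    refine PhragmenLindelof.right_half_plane_of_bounded_on_real (f := Q) ?_
      ⟨1, one_lt_two, A + 1, ?_⟩ ?_ ?_ ?_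
    · refine DifferentiableOn.diffContOnCl fun z hz ↦ ?_
      rw [Complex.closure_setOfPred_lt_re] at hz
      exact ((differentiable_entireXi.comp (by fun_prop : Differentiable ℂ fun z : ℂ ↦ z + d)
        z).div (differentiable_entireXi.comp (by fun_prop : Differentiable ℂ fun z : ℂ ↦ z + d + a)
        z) (hne z hz)).differentiableWithinAt
    · refine Asymptotics.IsBigO.of_bound (max K (C * 2 * Real.exp 2 * Real.exp A)) ?_
      refine eventually_inf_principal.mpr (Eventually.of_forall fun z hz ↦ ?_)
      rw [Real.rpow_one, Real.norm_of_nonneg (Real.exp_nonneg _)]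
      exact hQA z (le_of_lt hz)
    · refine ⟨K, ?_⟩
      rw [eventually_map]
      filter_upwards [eventually_ge_atTop 2] with x hx
      exact hQK x (by simpa using hx)
    · intro x
      rw [hQ, norm_div, norm_entireXi_eq_norm_add (a := a) (by simp [hd])]
      exact div_self_le_one _
    · simpa using hs
  have hs_ne := hne (s - d) (by simpa using hs)
  rw [hQ, norm_div, div_le_one (norm_pos_iff.mpr hs_ne)] at key
  simpa using key

theorem RiemannHypothesis.re_logDeriv_entireXi_nonneg (RH : RiemannHypothesis) {s : ℂ}
    (hs : 1 / 2 < s.re) : 0 ≤ (logDeriv entireXi s).re := by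
  have h₁ : HasDerivAt (fun a : ℝ ↦ entireXi (s + a)) (deriv entireXi s) 0 := by
    have := (differentiable_entireXi (s + (0 : ℝ))).hasDerivAt.comp_const_add s ((0 : ℝ) : ℂ)
    simpa using this.comp_ofReal
  have h₂ := h₁.norm_sq
  have h₃ := h₂.nonneg_of_eventually_le (by
    filter_upwards [Ioc_mem_nhdsGT zero_lt_one] with a ha
    have := RH.norm_entireXi_le_norm_add ha.1 ha.2 (s := s) (by linarith [ha.1])
    simp only [Complex.ofReal_zero, add_zero]
    gcongr)
  rw [logDeriv_apply, Complex.div_re, ← add_div]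
  refine div_nonneg ?_ (Complex.normSq_nonneg _)
  simp only [Complex.ofReal_zero, add_zero, Complex.inner, Complex.mul_re, Complex.conj_re,
    Complex.conj_im] at h₃
  linarith

theorem logDeriv_entireXi_eq {s : ℂ} (hs : 1 < s.re) :
    logDeriv entireXi s = 1 / s - 1 / (1 - s) + (-(Real.log Real.pi : ℂ) / 2 +
      Complex.digamma (s / 2) / 2) + logDeriv riemannZeta s := by
  have hs₀ : s ≠ 0 := by rintro rfl; norm_num at hs
  have hs₁ : s ≠ 1 := by rintro rfl; norm_num at hs
  have hs₂ : 1 - s ≠ 0 := sub_ne_zero.mpr hs₁.symm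
  have hπ : (Real.pi : ℂ) ≠ 0 := by simp
  have hre : 0 < (s / 2).re := by
    rw [show (2 : ℂ) = ((2 : ℝ) : ℂ) by norm_num, Complex.div_ofReal_re]; linarith
  have hX : entireXi =ᶠ[𝓝 s] fun w ↦ w * (1 - w) * ((Real.pi : ℂ) ^ (-w / 2) *
      Complex.Gamma (w / 2) * riemannZeta w) := by
    filter_upwards [Complex.continuous_re.continuousAt.eventually_const_lt hs] with w hw
    rw [entireXi_eq_riemannZeta (by linarith) (by rintro rfl; norm_num at hw),
      Complex.Gammaℝ_def]
  have hΓ : DifferentiableAt ℂ Complex.Gamma (s / 2) :=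
    Complex.differentiableAt_Gamma_of_re_pos hre
  have hΓ' : HasDerivAt (fun w ↦ Complex.Gamma (w / 2)) (deriv Complex.Gamma (s / 2) * (1 / 2)) s :=
    hΓ.hasDerivAt.comp s ((hasDerivAt_id s).div_const 2)
  have hpow : HasDerivAt (fun w : ℂ ↦ (Real.pi : ℂ) ^ (-w / 2))
      ((Real.pi : ℂ) ^ (-s / 2) * Complex.log Real.pi * (-1 / 2)) s :=
    ((hasDerivAt_id s).fun_neg.div_const 2).const_cpow (Or.inl hπ)
  have hζ := (differentiableAt_riemannZeta hs₁).hasDerivAt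
  have hpoly : HasDerivAt (fun w : ℂ ↦ w * (1 - w)) (1 * (1 - s) + s * -1) s :=
    (hasDerivAt_id s).fun_mul ((hasDerivAt_id s).const_sub 1)
  have hd := hpoly.fun_mul ((hpow.fun_mul hΓ').fun_mul hζ)
  rw [logDeriv_apply, hX.deriv_eq, hX.eq_of_nhds, hd.deriv, Complex.digamma_def, logDeriv_apply,
    logDeriv_apply, ← Complex.ofReal_log Real.pi_pos.le]
  have h₁ : (Real.pi : ℂ) ^ (-s / 2) ≠ 0 := by simp [Complex.cpow_eq_zero_iff]
  have h₂ := Complex.Gamma_ne_zero_of_re_pos hre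
  have h₃ := riemannZeta_ne_zero_of_one_le_re hs.le
  field_simp
  ring

theorem norm_logDeriv_entireXi_sub_digamma_le :
    ∃ C > 0, ∀ s : ℂ, 2 ≤ s.re →
      ‖logDeriv entireXi s - Complex.digamma (s / 2) / 2‖ ≤ C := by
  obtain ⟨C, hC, hζ⟩ := norm_logDeriv_riemannZeta_le
  refine ⟨2 + ‖-(Real.log Real.pi : ℂ) / 2‖ + C, by positivity, fun s hs ↦ ?_⟩
  have h₁ : 1 ≤ ‖s‖ := by linarith [Complex.re_le_norm s]
  have h₂ : 1 ≤ ‖1 - s‖ := by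
    rw [norm_sub_rev]
    refine le_trans ?_ (Complex.re_le_norm _)
    simp only [Complex.sub_re, Complex.one_re]; linarith
  have h₃ : ‖1 / s‖ ≤ 1 := by rw [norm_div, norm_one]; exact div_le_one_of_le₀ h₁ (by positivity)
  have h₄ : ‖1 / (1 - s)‖ ≤ 1 := by
    rw [norm_div, norm_one]; exact div_le_one_of_le₀ h₂ (by positivity)
  have h₅ : logDeriv entireXi s - Complex.digamma (s / 2) / 2 =
      1 / s - 1 / (1 - s) + -(Real.log Real.pi : ℂ) / 2 + logDeriv riemannZeta s := by
    rw [logDeriv_entireXi_eq (by linarith)]; ring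
  rw [h₅]
  refine norm_add₃_le.trans ?_
  linarith [norm_sub_le (1 / s) (1 / (1 - s)), hζ s hs]

theorem norm_logDeriv_entireXi_sub_le :
    ∃ C > 0, ∀ s c : ℂ, 2 ≤ s.re → 2 ≤ c.re →
      ‖logDeriv entireXi s - logDeriv entireXi c‖ ≤ C + ‖s - c‖ := by
  obtain ⟨C, hC, h⟩ := norm_logDeriv_entireXi_sub_digamma_le
  have half : ∀ s : ℂ, 2 ≤ s.re → 1 ≤ (s / 2).re := by
    intro s hs
    rw [show (2 : ℂ) = ((2 : ℝ) : ℂ) by norm_num, Complex.div_ofReal_re]; linarith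
  refine ⟨2 * C, by positivity, fun s c hs hc ↦ ?_⟩
  have h₁ := Complex.norm_digamma_sub_le (half s hs) (half c hc)
  rw [← sub_div, norm_div, Complex.norm_ofNat] at h₁
  have h₂ : ‖Complex.digamma (s / 2) / 2 - Complex.digamma (c / 2) / 2‖ ≤ ‖s - c‖ := by
    rw [← sub_div, norm_div, Complex.norm_ofNat]
    linarith [norm_nonneg (s - c)]
  have h₃ := h c hc
  rw [norm_sub_rev] at h₃
  calc _ = ‖logDeriv entireXi s - Complex.digamma (s / 2) / 2 +
        (Complex.digamma (c / 2) / 2 - logDeriv entireXi c) +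
        (Complex.digamma (s / 2) / 2 - Complex.digamma (c / 2) / 2)‖ := by ring_nf
    _ ≤ _ := norm_add₃_le
    _ ≤ 2 * C + ‖s - c‖ := by linarith [h s hs]

theorem log_le_re_logDeriv_entireXi :
    ∃ C > 0, ∀ t > 0, Real.log t / 2 - C ≤ (logDeriv entireXi (3 + t * Complex.I)).re := by
  obtain ⟨C, hC, h⟩ := norm_logDeriv_entireXi_sub_digamma_le
  have hlog := Real.log_pos one_lt_two
  refine ⟨Real.log 2 / 2 + 1 / 4 + |(Complex.digamma 1).re| / 2 + C, by positivity, fun t ht ↦ ?_⟩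
  have heq : (3 + t * Complex.I : ℂ) / 2 = (3 / 2 : ℝ) + (t / 2 : ℝ) * Complex.I := by
    push_cast; ring
  have h₁ := (abs_le.mp ((Complex.abs_re_le_norm _).trans (h (3 + t * Complex.I)
    (by simp; norm_num)))).1
  have h₂ := Complex.log_le_re_digamma (c := (3 / 2 : ℝ) + (t / 2 : ℝ) * Complex.I)
    (by simp; norm_num) (by simpa using ht)
  rw [heq, Complex.sub_re, show (2 : ℂ) = ((2 : ℝ) : ℂ) by norm_num, Complex.div_ofReal_re] at h₁
  have h₃ : ((3 / 2 : ℝ) + (t / 2 : ℝ) * Complex.I : ℂ).im = t / 2 := by simp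
  rw [h₃, Real.log_div ht.ne' two_ne_zero] at h₂
  linarith [neg_abs_le (Complex.digamma 1).re]

theorem norm_sub_le_norm_add_conj {w p : ℂ} (hw : 0 ≤ w.re) (hp : 0 ≤ p.re) :
    ‖w - p‖ ≤ ‖w + starRingEnd ℂ p‖ := by
  rw [Complex.norm_def, Complex.norm_def]
  apply Real.sqrt_le_sqrt
  simp only [Complex.normSq_apply, Complex.sub_re, Complex.sub_im, Complex.add_re, Complex.add_im,
    Complex.conj_re, Complex.conj_im]
  nlinarith [mul_nonneg hw hp]

theorem re_le_norm_add_conj {w p : ℂ} (hw : 0 ≤ w.re) : p.re ≤ ‖w + starRingEnd ℂ p‖ := by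
  refine le_trans ?_ (Complex.re_le_norm _)
  simpa using hw

theorem differentiableAt_logDeriv_entireXi {s : ℂ} (hs : entireXi s ≠ 0) :
    DifferentiableAt ℂ (logDeriv entireXi) s :=
  (differentiable_entireXi.deriv s).div (differentiable_entireXi s) hs

/-- On RH, `logDeriv entireXi` maps `re s > 1 / 2` to `re w ≥ 0`. The Cayley transform of it that
vanishes at `3 + t₀ * I` is small on discs around `3 + t * I`, hence also near the critical line. -/
theorem RiemannHypothesis.norm_logDeriv_entireXi_sub_le (RH : RiemannHypothesis) :
    ∃ C > 0, ∀ t₀ t x : ℝ, |t - t₀| ≤ 1 → ∀ p, p = logDeriv entireXi (3 + t₀ * Complex.I) →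
      C ≤ p.re → 0 < x → x < 1 →
      ‖logDeriv entireXi (1 / 2 + t * Complex.I + x) - p‖ ≤
        (C / p.re) ^ (x / 5) *
          ‖logDeriv entireXi (1 / 2 + t * Complex.I + x) + starRingEnd ℂ p‖ := by
  obtain ⟨C, hC, h⟩ := _root_.norm_logDeriv_entireXi_sub_le
  refine ⟨C + 2, by positivity, fun t₀ t x ht p hp hCp hx hx_one ↦ ?_⟩
  have hp_pos : 0 < p.re := by linarith
  set Φ := logDeriv entireXi with hΦ
  have hden : ∀ s : ℂ, 1 / 2 < s.re → Φ s + starRingEnd ℂ p ≠ 0 := fun s hs ↦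
    norm_pos_iff.mp (hp_pos.trans_le (re_le_norm_add_conj (RH.re_logDeriv_entireXi_nonneg hs)))
  have hre : ∀ z : ℂ, |z.re - 3| ≤ ‖z - (3 + t * Complex.I)‖ := fun z ↦ by
    simpa using Complex.abs_re_le_norm (z - (3 + t * Complex.I))
  have hball : ∀ z ∈ Metric.ball (3 + t * Complex.I) (5 / 2), 1 / 2 < z.re := by
    intro z hz
    rw [mem_ball_iff_norm] at hz
    linarith [(abs_lt.mp ((hre z).trans_lt hz)).1]
  have key := norm_le_rpow_of_three_circles (c := 3 + t * Complex.I) (ε := (C + 2) / p.re) (x := x)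
    (f := fun s ↦ (Φ s - p) / (Φ s + starRingEnd ℂ p)) ?_ ?_ (by positivity)
    ((div_le_one hp_pos).mpr hCp) ?_ hx hx_one
  · have heq : 3 + t * Complex.I - ((5 / 2 - x : ℝ) : ℂ) = 1 / 2 + t * Complex.I + x := by
      push_cast; ring
    rw [heq, norm_div, div_le_iff₀ (norm_pos_iff.mpr (hden _ (by simpa using hx)))] at key
    exact key
  · intro z hz
    have hd := differentiableAt_logDeriv_entireXi (RH.entireXi_ne_zero (hball z hz))
    exact ((hd.sub_const p).div (hd.add_const _) (hden z (hball z hz))).differentiableWithinAt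
  · intro z hz
    rw [norm_div]
    exact div_le_one_of_le₀ (norm_sub_le_norm_add_conj
      (RH.re_logDeriv_entireXi_nonneg (hball z hz)) hp_pos.le) (norm_nonneg _)
  · intro z hz
    rw [mem_closedBall_iff_norm] at hz
    have hz_re : 2 ≤ z.re := by linarith [(abs_le.mp ((hre z).trans hz)).1]
    rw [norm_div]
    refine div_le_div₀ (by positivity) ?_ hp_pos
      (re_le_norm_add_conj (RH.re_logDeriv_entireXi_nonneg (by linarith)))
    rw [hp]
    refine (h z _ hz_re (by simp; norm_num)).trans ?_
    gcongr
    calc ‖z - (3 + t₀ * Complex.I)‖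
        = ‖z - (3 + t * Complex.I) + ((t - t₀ : ℝ) : ℂ) * Complex.I‖ := by push_cast; ring_nf
      _ ≤ ‖z - (3 + t * Complex.I)‖ + ‖((t - t₀ : ℝ) : ℂ) * Complex.I‖ := norm_add_le _ _
      _ ≤ 1 + 1 := by
        gcongr
        rwa [norm_mul, Complex.norm_I, mul_one, Complex.norm_real]
      _ = 2 := by norm_num

theorem hasDerivAt_one_half_add_mul_I {f : ℂ → ℂ} {t : ℝ}
    (hf : DifferentiableAt ℂ f (1 / 2 + t * Complex.I)) :
    HasDerivAt (fun u : ℝ ↦ f (1 / 2 + u * Complex.I))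
      (deriv f (1 / 2 + t * Complex.I) * Complex.I) t := by
  have h : HasDerivAt (fun u : ℝ ↦ (1 / 2 + u * Complex.I : ℂ)) Complex.I t := by
    simpa using ((hasDerivAt_id t).ofReal_comp.mul_const Complex.I).const_add (1 / 2)
  exact hf.hasDerivAt.comp t h

theorem HasDerivAt.im_comp {f : ℝ → ℂ} {f' : ℂ} {t : ℝ} (hf : HasDerivAt f f' t) :
    HasDerivAt (fun u ↦ (f u).im) f'.im t :=
  Complex.imCLM.hasFDerivAt.comp_hasDerivAt t hf

theorem re_logDeriv_entireXi_eq_zero (t : ℝ) :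
    (logDeriv entireXi (1 / 2 + t * Complex.I)).re = 0 := by
  have him : ∀ u : ℝ, (entireXi (1 / 2 + u * Complex.I)).im = 0 := fun u ↦ by
    rw [mul_comm]; exact entireXi_im_eq_zero u
  have h := (hasDerivAt_one_half_add_mul_I
    (differentiable_entireXi (1 / 2 + t * Complex.I))).im_comp
  have h₁ : (deriv entireXi (1 / 2 + t * Complex.I)).re = 0 := by
    have := h.unique ((hasDerivAt_const t (0 : ℝ)).congr_of_eventuallyEq
      (Eventually.of_forall him))
    simpa using this
  rw [logDeriv_apply, Complex.div_re, h₁, him]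
  simp

theorem mul_le_re_deriv_logDeriv_entireXi {p : ℂ} {t m : ℝ}
    (ht : entireXi (1 / 2 + t * Complex.I) ≠ 0)
    (hm : ∀ x : ℝ, 0 < x → x < 1 → ‖logDeriv entireXi (1 / 2 + t * Complex.I + x) - p‖ ^ 2 ≤
      ‖logDeriv entireXi (1 / 2 + t * Complex.I + x) + starRingEnd ℂ p‖ ^ 2 *
        Real.exp (-(m * x))) :
    m * (p.re ^ 2 + ((logDeriv entireXi (1 / 2 + t * Complex.I)).im - p.im) ^ 2) ≤
      4 * p.re * (deriv (logDeriv entireXi) (1 / 2 + t * Complex.I)).re := by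
  set Φ := logDeriv entireXi with hΦ
  set s : ℂ := 1 / 2 + t * Complex.I with hs
  have h₁ : HasDerivAt (fun x : ℝ ↦ Φ (s + x)) (deriv Φ s) 0 := by
    have hd : DifferentiableAt ℂ Φ (s + (0 : ℝ)) := by
      simpa using differentiableAt_logDeriv_entireXi ht
    simpa using (hd.hasDerivAt.comp_const_add s ((0 : ℝ) : ℂ)).comp_ofReal
  have h₂ : HasDerivAt (fun x : ℝ ↦ Real.exp (-(m * x))) (-m) 0 := by
    simpa using ((hasDerivAt_id (0 : ℝ)).const_mul m).fun_neg.exp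
  have h₃ := ((h₁.add_const (starRingEnd ℂ p)).norm_sq.fun_mul h₂).fun_sub
    (h₁.sub_const p).norm_sq
  have hre : (Φ s).re = 0 := re_logDeriv_entireXi_eq_zero t
  have h₄ : ‖Φ s + starRingEnd ℂ p‖ ^ 2 = p.re ^ 2 + ((Φ s).im - p.im) ^ 2 := by
    rw [← Complex.normSq_eq_norm_sq, Complex.normSq_apply]
    simp [hre]; ring
  have h₅ : ‖Φ s - p‖ ^ 2 = p.re ^ 2 + ((Φ s).im - p.im) ^ 2 := by
    rw [← Complex.normSq_eq_norm_sq, Complex.normSq_apply]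
    simp [hre]; ring
  have h₆ := h₃.nonneg_of_eventually_le (by
    filter_upwards [Ioo_mem_nhdsGT zero_lt_one] with x hx
    simp only [Complex.ofReal_zero, add_zero, mul_zero, neg_zero, Real.exp_zero, mul_one, h₄, h₅,
      sub_self]
    linarith [hm x hx.1 hx.2])
  simp only [Complex.ofReal_zero, add_zero, mul_zero, neg_zero, Real.exp_zero, mul_one, h₄,
    Complex.inner, Complex.mul_re, Complex.conj_re, Complex.conj_im, Complex.add_re,
    Complex.add_im, Complex.sub_re, Complex.sub_im, hre] at h₆
  linarith

theorem mul_sub_lt_pi_of_hasDerivAt {u u' : ℝ → ℝ} {a b c l : ℝ} (hab : a ≤ b) (hl : 0 < l)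
    (hu : ∀ t ∈ Set.Icc a b, HasDerivAt u (u' t) t)
    (hu' : ∀ t ∈ Set.Icc a b, c * (l ^ 2 + u t ^ 2) ≤ l * u' t) : c * (b - a) < Real.pi := by
  have hd : ∀ t ∈ Set.Icc a b, HasDerivAt (fun t ↦ Real.arctan (u t / l))
      (1 / (1 + (u t / l) ^ 2) * (u' t / l)) t := fun t ht ↦ ((hu t ht).div_const l).arctan
  have h := Convex.mul_sub_le_image_sub_of_le_deriv (convex_Icc a b)
    (fun t ht ↦ (hd t ht).continuousAt.continuousWithinAt)
    (fun t ht ↦ (hd t (interior_subset ht)).differentiableAt.differentiableWithinAt) (C := c)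
    (fun t ht ↦ by
      rw [(hd t (interior_subset ht)).deriv]
      have : 1 / (1 + (u t / l) ^ 2) * (u' t / l) = l * u' t / (l ^ 2 + u t ^ 2) := by
        have : l ^ 2 + u t ^ 2 ≠ 0 := by positivity
        field_simp
      rw [this, le_div_iff₀ (by positivity)]
      exact hu' t (interior_subset ht))
    a (Set.left_mem_Icc.mpr hab) b (Set.right_mem_Icc.mpr hab) hab
  linarith [Real.arctan_lt_pi_div_two (u b / l), Real.neg_pi_div_two_lt_arctan (u a / l)]

theorem RiemannHypothesis.exists_hardyZ_eq_zero_of_le (RH : RiemannHypothesis) :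
    ∃ C > 0, ∀ a b l : ℝ, a ≤ b → b ≤ a + 1 →
      l = (logDeriv entireXi (3 + a * Complex.I)).re → C < l →
      10 * Real.pi ≤ Real.log (l / C) * (b - a) → ∃ t ∈ Set.Icc a b, hardyZ t = 0 := by
  obtain ⟨C, hC, h⟩ := RH.norm_logDeriv_entireXi_sub_le
  refine ⟨C, hC, fun a b l hab hba hl hCl hlog ↦ ?_⟩
  by_contra! hne
  have hl_pos : 0 < l := hC.trans hCl
  set p := logDeriv entireXi (3 + a * Complex.I) with hp
  have hX : ∀ t ∈ Set.Icc a b, entireXi (1 / 2 + t * Complex.I) ≠ 0 := fun t ht h₀ ↦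
    hne t ht ((hardyZ_eq_zero_iff t).mpr (by rwa [mul_comm]))
  have hd : ∀ t ∈ Set.Icc a b,
      HasDerivAt (fun t : ℝ ↦ (logDeriv entireXi (1 / 2 + t * Complex.I)).im - p.im)
        (deriv (logDeriv entireXi) (1 / 2 + t * Complex.I)).re t := fun t ht ↦ by
    have := (hasDerivAt_one_half_add_mul_I
      (differentiableAt_logDeriv_entireXi (hX t ht))).im_comp.sub_const p.im
    simpa using this
  have key := mul_sub_lt_pi_of_hasDerivAt (c := Real.log (l / C) / 10) hab hl_pos hd
    (fun t ht ↦ by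
      have := mul_le_re_deriv_logDeriv_entireXi (p := p)
        (m := 2 / 5 * Real.log (l / C)) (hX t ht) fun x hx hx_one ↦ by
          have h₁ := h a t x (abs_le.mpr ⟨by linarith [ht.1], by linarith [ht.2]⟩) p rfl
            (by linarith) hx hx_one
          have h₂ := pow_le_pow_left₀ (norm_nonneg _) h₁ 2
          refine h₂.trans_eq ?_
          rw [mul_pow, mul_comm, ← hl, Real.rpow_def_of_pos (by positivity), ← Real.exp_nat_mul,
            Real.log_div hC.ne' hl_pos.ne', Real.log_div hl_pos.ne' hC.ne']
          congr 2
          push_cast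
          ring
      rw [← hl] at this
      linarith)
  linarith

/-- On RH, gaps between the zeros of `hardyZ` at height `t` are `O(1 / log log t)`. -/
theorem RiemannHypothesis.exists_hardyZ_eq_zero (RH : RiemannHypothesis) :
    ∃ K > 0, ∀ᶠ t : ℝ in atTop,
      ∃ γ ∈ Set.Icc t (t + K / Real.log (Real.log t)), hardyZ γ = 0 := by
  obtain ⟨C, hC, h⟩ := RH.exists_hardyZ_eq_zero_of_le
  obtain ⟨C', hC', h'⟩ := log_le_re_logDeriv_entireXi
  refine ⟨20 * Real.pi, by positivity, ?_⟩
  have hlog := Real.tendsto_log_atTop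
  have hev : ∀ᶠ y : ℝ in atTop, C * y ^ (1 / 2 : ℝ) ≤ y / 2 - C' := by
    have hr := tendsto_rpow_atTop (show (0 : ℝ) < 1 / 2 by norm_num)
    filter_upwards [hr.eventually_ge_atTop (2 * (C + 1)), hr.eventually_ge_atTop C',
      eventually_ge_atTop 0] with y hy hy' hy₀
    have hsq : y ^ (1 / 2 : ℝ) * y ^ (1 / 2 : ℝ) = y := by
      rw [← Real.sqrt_eq_rpow, Real.mul_self_sqrt hy₀]
    nlinarith
  filter_upwards [eventually_gt_atTop 0, hlog.eventually hev, hlog.eventually_gt_atTop 1,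
    (hlog.comp hlog).eventually_ge_atTop (20 * Real.pi)] with t ht hC't hlog_one hK
  simp only [Function.comp_apply] at hK
  have hπ := Real.pi_pos
  have hll : 0 < Real.log (Real.log t) := by linarith
  have hl := hC't.trans (h' t ht)
  have hrpow : 1 < Real.log t ^ (1 / 2 : ℝ) := Real.one_lt_rpow hlog_one (by norm_num)
  refine h t _ _ (le_add_of_nonneg_right (by positivity)) ?_ rfl (by nlinarith) ?_
  · gcongr
    exact (div_le_one hll).mpr hK
  · have h₁ : Real.log (Real.log t) / 2 ≤
        Real.log ((logDeriv entireXi (3 + t * Complex.I)).re / C) := by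
      have h₂ : Real.log (Real.log t) / 2 = Real.log (Real.log t ^ (1 / 2 : ℝ)) := by
        rw [Real.log_rpow (by linarith)]; ring
      rw [h₂]
      apply Real.log_le_log (by positivity)
      rwa [le_div_iff₀' hC]
    calc 10 * Real.pi
        = Real.log (Real.log t) / 2 * (t + 20 * Real.pi / Real.log (Real.log t) - t) := by
          field_simp; ring
      _ ≤ _ := by
          gcongr
          rw [add_sub_cancel_left]; positivity

/-- Theorem 3: on RH, there is `B > 0` such that for all sufficiently large `T` and every
`1 ≤ k ≤ ⌊B·ln ln T / ln ln ln T⌋`, the interval `(T, T + 1/ln ln ln T)` contains a root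
of odd order of `Z^{(k)}`, witnessed by a sign change of `Z^{(k)}`. -/
theorem packed_zeros_of_derivatives_RH (RH : RiemannHypothesis) :
    ∃ B > (0:ℝ), ∀ᶠ T in Filter.atTop,
      ∀ k : ℕ, 1 ≤ k →
        k ≤ ⌊B * Real.log (Real.log T) / Real.log (Real.log (Real.log T))⌋₊ →
        ∃ t₁ t₂ : ℝ,
          T < t₁ ∧ t₁ < t₂ ∧ t₂ < T + 1 / Real.log (Real.log (Real.log T)) ∧
          iteratedDeriv k hardyZ t₁ * iteratedDeriv k hardyZ t₂ < 0 := by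
  obtain ⟨K, hK, h⟩ := RH.exists_hardyZ_eq_zero
  obtain ⟨N, hN⟩ := eventually_atTop.mp h
  refine ⟨1 / (4 * K), by positivity, ?_⟩
  have hlog := Real.tendsto_log_atTop
  filter_upwards [eventually_ge_atTop N, eventually_gt_atTop 0, hlog.eventually_gt_atTop 1,
    (hlog.comp hlog).eventually_gt_atTop 1] with T hT hT₀ hT₁ hT₂ k hk hkT
  simp only [Function.comp_apply] at hT₂
  have hll : 0 < Real.log (Real.log T) := by linarith
  have hlll : 0 < Real.log (Real.log (Real.log T)) := Real.log_pos hT₂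
  set g := 2 * K / Real.log (Real.log T) with hg_def
  have hg : 0 < g := by positivity
  have hkB := (Nat.le_floor_iff (by positivity)).mp hkT
  have hkg : (k + 1 : ℝ) * g ≤ 1 / Real.log (Real.log (Real.log T)) := by
    have hk₁ : (1 : ℝ) ≤ k := by exact_mod_cast hk
    calc (k + 1 : ℝ) * g ≤ 2 * k * g := by gcongr; linarith
      _ ≤ 2 * (1 / (4 * K) * Real.log (Real.log T) / Real.log (Real.log (Real.log T))) * g := by
        gcongr
      _ = _ := by rw [hg_def]; field_simp; ring
  have hz : ∀ j : ℕ, ∃ z, T + j * g < z ∧ z < T + (j + 1) * g ∧ hardyZ z = 0 := by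
    intro j
    have hTj : T ≤ T + (j + 1 / 4) * g := le_add_of_nonneg_right (by positivity)
    obtain ⟨z, hz, hz₀⟩ := hN _ (hT.trans hTj)
    have hlen : K / Real.log (Real.log (T + (j + 1 / 4) * g)) ≤ g / 2 := by
      have hg_half : g / 2 = K / Real.log (Real.log T) := by rw [hg_def]; ring
      rw [hg_half]
      gcongr
    exact ⟨z, by linarith [hz.1], by linarith [hz.2], hz₀⟩
  choose z hz_gt hz_lt hz₀ using hz
  obtain ⟨t₁, t₂, h₁, h₁₂, h₂, hneg⟩ := exists_sign_change_iteratedDeriv hk analyticOnNhd_hardyZ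
    hardyZ_ne_zero z (fun i _ ↦ (hz_lt i).trans (by exact_mod_cast hz_gt (i + 1)))
    (fun i _ ↦ hz₀ i)
  refine ⟨t₁, t₂, ?_, h₁₂, ?_, hneg⟩
  · have := hz_gt 0
    simp only [Nat.cast_zero, zero_mul, add_zero] at this
    exact this.trans_le h₁
  · linarith [hz_lt k]
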